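/- arXiv:1909.05047 — 9 statements merged into one kernel-verified Lean document; each statement's English description precedes it below -/
import Mathlib

section
/- For all x, y with x* ≤ x < y, H(0,y) − H(0,x) < m(0,x)(π_μ(x) − π_μ(y)) ≤ 0; in particular, the function x ↦ H(0,x) is strictly decreasing on [x*, ∞). -/
open MeasureTheory Filter

/-- On an interval `(x, y]`, a strictly increasing function integrated against a positive weight
stays strictly below its value at `y` times the mass of the weight. -/
theorem setIntegral_mul_lt_mul_setIntegral {f w : ℝ → ℝ} {x y : ℝ} (hxy : x < y)
    (hf : StrictMonoOn f (Set.Icc x y)) (hw : ∀ z ∈ Set.Ioo x y, 0 < w z)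
    (hwi : IntegrableOn w (Set.Ioc x y)) (hfwi : IntegrableOn (fun z => f z * w z) (Set.Ioc x y)) :
    ∫ z in Set.Ioc x y, f z * w z < f y * ∫ z in Set.Ioc x y, w z := by
  have hpos : 0 < ∫ z in x..y, (f y * w z - f z * w z) := by
    refine intervalIntegral.intervalIntegral_pos_of_pos_on ?_ (fun z hz => ?_) hxy
    · rw [intervalIntegrable_iff_integrableOn_Ioc_of_le hxy.le]
      exact (hwi.const_mul _).sub hfwi
    · rw [← sub_mul]
      exact mul_pos (sub_pos.2 (hf ⟨hz.1.le, hz.2.le⟩ ⟨hxy.le, le_rfl⟩ hz.2)) (hw z hz)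
  rw [intervalIntegral.integral_of_le hxy.le, integral_sub (hwi.const_mul _) hfwi,
    integral_const_mul] at hpos
  linarith

/-- Splitting an integral over `(a, c]` at an intermediate point. -/
theorem setIntegral_Ioc_add_setIntegral_Ioc {f : ℝ → ℝ} {a b c : ℝ} (hab : a ≤ b) (hbc : b ≤ c)
    (hf : IntegrableOn f (Set.Ioc a c)) :
    ∫ z in Set.Ioc a c, f z = (∫ z in Set.Ioc a b, f z) + ∫ z in Set.Ioc b c, f z := by
  rw [← Set.Ioc_union_Ioc_eq_Ioc hab hbc]
  exact setIntegral_union (Set.Ioc_disjoint_Ioc_of_le le_rfl) measurableSet_Ioc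
    (hf.mono_set (Set.Ioc_subset_Ioc_right hbc)) (hf.mono_set (Set.Ioc_subset_Ioc_left hab))

/-- For all x, y with x* ≤ x < y,
    H(0,y) − H(0,x) < m(0,x)(π_μ(x) − π_μ(y)) ≤ 0; in particular,
    x ↦ H(0,x) is strictly decreasing on [x*, ∞). -/
theorem stmt_2
    (μ σ pf : ℝ → ℝ) (c : ℝ) (hc : 0 < c)
    (hμc : ContinuousOn μ (Set.Ioi 0)) (hσc : ContinuousOn σ (Set.Ioi 0))
    (hσ : ∀ x > 0, 0 < σ x)
    (S' m' : ℝ → ℝ)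
    (hS'def : ∀ x > 0, S' x = Real.exp (-(∫ z in c..x, 2 * μ z / σ z ^ 2)))
    (hm'def : ∀ x > 0, m' x = 2 / (σ x ^ 2 * S' x))
    (m0 : ℝ → ℝ) (hm0def : ∀ x > 0, m0 x = ∫ z in Set.Ioc 0 x, m' z)
    (hpfc : ContinuousOn pf (Set.Ioi 0)) (hpfnn : ∀ x > 0, 0 ≤ pf x)
    (γ : ℝ) (hγ : 0 < γ)
    (pmu : ℝ → ℝ) (hpmudef : ∀ x > 0, pmu x = pf x + γ * μ x)
    (H : ℝ → ℝ)
    (hHdef : ∀ x > 0, H x = (∫ z in Set.Ioc 0 x, pmu z * m' z) - pmu x * m0 x)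
    (xstar : ℝ) (hxstar : 0 < xstar)
    (hinc : StrictMonoOn pmu (Set.Ici xstar))
    (hmi : ∀ y > 0, IntegrableOn m' (Set.Ioc 0 y))
    (hpmi : ∀ y > 0, IntegrableOn (fun z => pmu z * m' z) (Set.Ioc 0 y)) :
    (∀ x y, xstar ≤ x → x < y →
      H y - H x < m0 x * (pmu x - pmu y) ∧ m0 x * (pmu x - pmu y) ≤ 0) ∧
    StrictAntiOn H (Set.Ici xstar) := by
  have hm'pos : ∀ z > 0, 0 < m' z := fun z hz => by
    rw [hm'def z hz, hS'def z hz]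
    have := hσ z hz
    positivity
  have hmain : ∀ x y, xstar ≤ x → x < y →
      H y - H x < m0 x * (pmu x - pmu y) ∧ m0 x * (pmu x - pmu y) ≤ 0 := by
    intro x y hx hxy
    have hx0 : 0 < x := hxstar.trans_le hx
    have hy0 : 0 < y := hx0.trans hxy
    have hsub : Set.Ioc x y ⊆ Set.Ioc 0 y := Set.Ioc_subset_Ioc_left hx0.le
    constructor
    · have hlt := setIntegral_mul_lt_mul_setIntegral hxy
        (hinc.mono fun z hz => hx.trans hz.1) (fun z hz => hm'pos z (hx0.trans hz.1))
        ((hmi y hy0).mono_set hsub) ((hpmi y hy0).mono_set hsub)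
      rw [hHdef y hy0, hHdef x hx0, hm0def y hy0, hm0def x hx0,
        setIntegral_Ioc_add_setIntegral_Ioc hx0.le hxy.le (hmi y hy0),
        setIntegral_Ioc_add_setIntegral_Ioc hx0.le hxy.le (hpmi y hy0)]
      linarith
    · have hm0 : 0 ≤ m0 x := by
        rw [hm0def x hx0]
        exact setIntegral_nonneg measurableSet_Ioc fun z hz => (hm'pos z hz.1).le
      exact mul_nonpos_of_nonneg_of_nonpos hm0
        (sub_nonpos.2 (hinc hx (hx.trans hxy.le) hxy).le)
  refine ⟨hmain, fun x hx y _ hxy => ?_⟩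
  obtain ⟨hlt, hle⟩ := hmain x y hx hxy
  linarith
end

section
/- For all x, y with 0 < x < y ≤ x*, H(0,y) − H(0,x) > m(0,x)(π_μ(x) − π_μ(y)) ≥ 0, and moreover H(0,x) > 0 for every x ∈ (0, x*); in particular, the function x ↦ H(0,x) is strictly increasing and positive on (0, x*). -/
open MeasureTheory Filter

theorem lt_setIntegral_mul_of_strictAntiOn {f w : ℝ → ℝ} {a b x y : ℝ}
    (hf : StrictAntiOn f (Set.Ioc a b)) (hw : ∀ z ∈ Set.Ioc a b, 0 < w z)
    (hax : a ≤ x) (hxy : x < y) (hyb : y ≤ b)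
    (hwi : IntegrableOn w (Set.Ioc x y)) (hfwi : IntegrableOn (fun z => f z * w z) (Set.Ioc x y)) :
    f y * ∫ z in Set.Ioc x y, w z < ∫ z in Set.Ioc x y, f z * w z := by
  have hi : IntegrableOn (fun z => f z * w z - f y * w z) (Set.Ioc x y) :=
    hfwi.sub (hwi.const_mul _)
  have hpos : 0 < ∫ z in x..y, (f z * w z - f y * w z) := by
    refine intervalIntegral.intervalIntegral_pos_of_pos_on
      ((intervalIntegrable_iff_integrableOn_Ioc_of_le hxy.le).2 hi) (fun z hz => ?_) hxy
    have hza : z ∈ Set.Ioc a b := ⟨hax.trans_lt hz.1, hz.2.le.trans hyb⟩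
    rw [← sub_mul]
    exact mul_pos (sub_pos.2 (hf hza ⟨hax.trans_lt hxy, hyb⟩ hz.2)) (hw z hza)
  rw [intervalIntegral.integral_of_le hxy.le, integral_sub hfwi (hwi.const_mul _),
    integral_const_mul] at hpos
  exact sub_pos.1 hpos

theorem setIntegral_Ioc_add_adjacent {f : ℝ → ℝ} {a x y : ℝ} (hax : a ≤ x) (hxy : x ≤ y)
    (hf : IntegrableOn f (Set.Ioc a y)) :
    ∫ z in Set.Ioc a y, f z = (∫ z in Set.Ioc a x, f z) + ∫ z in Set.Ioc x y, f z := by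
  rw [← Set.Ioc_union_Ioc_eq_Ioc hax hxy]
  exact setIntegral_union (Set.Ioc_disjoint_Ioc_of_le le_rfl) measurableSet_Ioc
    (hf.mono_set (Set.Ioc_subset_Ioc_right hxy)) (hf.mono_set (Set.Ioc_subset_Ioc_left hax))

/-- For all 0 < x < y ≤ x*,
    H(0,y) − H(0,x) > m(0,x)(π_μ(x) − π_μ(y)) ≥ 0, and H(0,x) > 0 on (0, x*);
    in particular x ↦ H(0,x) is strictly increasing and positive on (0, x*). -/
theorem stmt_3
    (μ σ pf : ℝ → ℝ) (c : ℝ) (hc : 0 < c)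
    (hμc : ContinuousOn μ (Set.Ioi 0)) (hσc : ContinuousOn σ (Set.Ioi 0))
    (hσ : ∀ x > 0, 0 < σ x)
    (S' m' : ℝ → ℝ)
    (hS'def : ∀ x > 0, S' x = Real.exp (-(∫ z in c..x, 2 * μ z / σ z ^ 2)))
    (hm'def : ∀ x > 0, m' x = 2 / (σ x ^ 2 * S' x))
    (m0 : ℝ → ℝ) (hm0def : ∀ x > 0, m0 x = ∫ z in Set.Ioc 0 x, m' z)
    (hpfc : ContinuousOn pf (Set.Ioi 0)) (hpfnn : ∀ x > 0, 0 ≤ pf x)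
    (γ : ℝ) (hγ : 0 < γ)
    (pmu : ℝ → ℝ) (hpmudef : ∀ x > 0, pmu x = pf x + γ * μ x)
    (H : ℝ → ℝ)
    (hHdef : ∀ x > 0, H x = (∫ z in Set.Ioc 0 x, pmu z * m' z) - pmu x * m0 x)
    (xstar : ℝ) (hxstar : 0 < xstar)
    (hdec : StrictAntiOn pmu (Set.Ioc 0 xstar))
    (hmi : ∀ y > 0, IntegrableOn m' (Set.Ioc 0 y))
    (hpmi : ∀ y > 0, IntegrableOn (fun z => pmu z * m' z) (Set.Ioc 0 y)) :
    (∀ x y, 0 < x → x < y → y ≤ xstar →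
      m0 x * (pmu x - pmu y) < H y - H x ∧ 0 ≤ m0 x * (pmu x - pmu y)) ∧
    (∀ x ∈ Set.Ioo 0 xstar, 0 < H x) ∧
    StrictMonoOn H (Set.Ioo 0 xstar) := by
  have hm' : ∀ x > 0, 0 < m' x := fun x hx => by
    have := hσ x hx
    rw [hm'def x hx, hS'def x hx]
    positivity
  have hpos : ∀ x ∈ Set.Ioc 0 xstar, 0 < H x := fun x hx => by
    rw [hHdef x hx.1, hm0def x hx.1]
    exact sub_pos.2 (lt_setIntegral_mul_of_strictAntiOn hdec (fun z hz => hm' z hz.1) le_rfl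
      hx.1 hx.2 (hmi x hx.1) (hpmi x hx.1))
  have hinc : ∀ x y, 0 < x → x < y → y ≤ xstar →
      m0 x * (pmu x - pmu y) < H y - H x ∧ 0 ≤ m0 x * (pmu x - pmu y) := by
    intro x y hx hxy hy
    have hy0 : 0 < y := hx.trans hxy
    have hsub : Set.Ioc x y ⊆ Set.Ioc 0 y := Set.Ioc_subset_Ioc_left hx.le
    constructor
    · have key := lt_setIntegral_mul_of_strictAntiOn hdec (fun z hz => hm' z hz.1) hx.le hxy hy
        ((hmi y hy0).mono_set hsub) ((hpmi y hy0).mono_set hsub)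
      rw [hHdef x hx, hHdef y hy0, hm0def x hx, hm0def y hy0,
        setIntegral_Ioc_add_adjacent hx.le hxy.le (hmi y hy0),
        setIntegral_Ioc_add_adjacent hx.le hxy.le (hpmi y hy0)]
      linarith
    · refine mul_nonneg ?_ (sub_nonneg.2 (hdec ⟨hx, hxy.le.trans hy⟩ ⟨hy0, hy⟩ hxy).le)
      rw [hm0def x hx]
      exact setIntegral_nonneg measurableSet_Ioc fun z hz => (hm' z hz.1).le
  refine ⟨hinc, fun x hx => hpos x ⟨hx.1, hx.2.le⟩, fun x hx y hy hxy => ?_⟩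
  obtain ⟨h₁, h₂⟩ := hinc x y hx.1 hxy hy.2.le
  exact sub_pos.1 (h₂.trans_lt h₁)
end

section
/- The equation S'(x) m(0,x) L(x) = −φ_λ'(x) H(0,x) has a unique solution x̄ in (0,∞), and moreover x̄ ∈ (x̃, x̂), where x̃ ∈ (0, x*) is the unique root of L and x̂ ∈ (x*, ∞) is the unique root of x ↦ H(0,x). -/
open MeasureTheory Filter Set Topology

section Primitives

variable {f : ℝ → ℝ}

lemma hasDerivAt_setIntegral_Ioc_zero (hf : ContinuousOn f (Ioi 0))
    (hi : ∀ y > 0, IntegrableOn f (Ioc 0 y)) {x : ℝ} (hx : 0 < x) :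
    HasDerivAt (fun y => ∫ z in Ioc 0 y, f z) (f x) x := by
  have h := intervalIntegral.integral_hasDerivAt_right
    ((intervalIntegrable_iff_integrableOn_Ioc_of_le hx.le).2 (hi x hx))
    (hf.stronglyMeasurableAtFilter isOpen_Ioi x hx) (hf.continuousAt (Ioi_mem_nhds hx))
  refine h.congr_of_eventuallyEq ?_
  filter_upwards [Ioi_mem_nhds hx] with y hy
  exact (intervalIntegral.integral_of_le (le_of_lt hy)).symm

lemma hasDerivAt_setIntegral_Ioi (hf : ContinuousOn f (Ioi 0))
    (hi : ∀ y > 0, IntegrableOn f (Ioi y)) {x : ℝ} (hx : 0 < x) :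
    HasDerivAt (fun y => ∫ z in Ioi y, f z) (-f x) x := by
  have h := intervalIntegral.integral_hasDerivAt_right (IntervalIntegrable.refl (a := x))
    (hf.stronglyMeasurableAtFilter isOpen_Ioi x hx) (hf.continuousAt (Ioi_mem_nhds hx))
  refine (h.const_sub (∫ z in Ioi x, f z)).congr_of_eventuallyEq ?_
  filter_upwards [Ioi_mem_nhds hx] with y hy
  exact eq_sub_of_add_eq'
    (intervalIntegral.integral_interval_add_Ioi (hi x hx) (hi y hy))

lemma tendsto_setIntegral_Ioc_zero (hi : IntegrableOn f (Ioc 0 1)) :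
    Tendsto (fun y => ∫ z in Ioc 0 y, f z) (𝓝[>] 0) (𝓝 0) := by
  have h := intervalIntegral.continuousOn_primitive (a := 0) (b := 1)
    ((integrableOn_Icc_iff_integrableOn_Ioc (by simp)).2 hi) 0 (by simp)
  have h' := h.mono_left (nhdsWithin_le_of_mem (s := Icc 0 1) (t := Ioi (0 : ℝ)) ?_)
  · simpa using h'
  · exact mem_of_superset (Ioo_mem_nhdsGT one_pos) Ioo_subset_Icc_self

lemma tendsto_setIntegral_Ioi_atTop {a : ℝ} (hi : IntegrableOn f (Ioi a)) :
    Tendsto (fun y => ∫ z in Ioi y, f z) atTop (𝓝 0) := by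
  have h := (intervalIntegral_tendsto_integral_Ioi a hi tendsto_id).const_sub
    (∫ z in Ioi a, f z)
  rw [sub_self] at h
  refine h.congr' ?_
  filter_upwards [eventually_ge_atTop a] with y hy
  exact sub_eq_of_eq_add' (intervalIntegral.integral_interval_add_Ioi hi
    (hi.mono_set (Ioi_subset_Ioi hy))).symm

end Primitives

section Monotonicity

variable {f f' : ℝ → ℝ}

lemma lt_of_hasDerivAt_pos {a b : ℝ} (hab : a < b) (hf : ∀ x ∈ Icc a b, HasDerivAt f (f' x) x)
    (hpos : ∀ x ∈ Ioo a b, 0 < f' x) : f a < f b := by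
  refine strictMonoOn_of_hasDerivWithinAt_pos (f' := f') (convex_Icc a b)
    (fun x hx => (hf x hx).continuousAt.continuousWithinAt) ?_ ?_
    (left_mem_Icc.2 hab.le) (right_mem_Icc.2 hab.le) hab
  · intro x hx
    exact (hf x (interior_subset hx)).hasDerivWithinAt
  · rwa [interior_Icc]

lemma pos_of_hasDerivAt_neg_of_tendsto_atTop {a : ℝ}
    (hf : ∀ x ∈ Ici a, HasDerivAt f (f' x) x) (hneg : ∀ x ∈ Ioi a, f' x < 0)
    (hlim : Tendsto f atTop (𝓝 0)) : 0 < f a := by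
  have hanti : ∀ x ∈ Ici a, ∀ y, x < y → f y < f x := fun x hx y hxy => by
    have := lt_of_hasDerivAt_pos (f := fun z => -f z) (f' := fun z => -f' z) hxy
      (fun z hz => (hf z (hx.trans hz.1)).neg)
      (fun z hz => neg_pos.2 (hneg z (lt_of_le_of_lt hx hz.1)))
    simpa using this
  have h1 := hanti a self_mem_Ici (a + 1) (by linarith)
  have h2 : 0 ≤ f (a + 1) := le_of_tendsto hlim <| by
    filter_upwards [eventually_gt_atTop (a + 1)] with y hy
    exact (hanti _ (by simp) y hy).le
  linarith

lemma pos_of_hasDerivAt_pos_of_tendsto_zero {a : ℝ} (ha : 0 < a)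
    (hf : ∀ x > 0, HasDerivAt f (f' x) x) (hpos : ∀ x ∈ Ioo 0 a, 0 < f' x)
    (hlim : Tendsto f (𝓝[>] 0) (𝓝 0)) : 0 < f a := by
  have hmono : ∀ x > 0, ∀ y ≤ a, x < y → f x < f y := fun x hx y hy hxy =>
    lt_of_hasDerivAt_pos hxy (fun z hz => hf z (hx.trans_le hz.1))
      (fun z hz => hpos z ⟨hx.trans hz.1, hz.2.trans_le hy⟩)
  have h1 := hmono (a / 2) (by linarith) a le_rfl (by linarith)
  have h2 : 0 ≤ f (a / 2) := le_of_tendsto hlim <| by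
    filter_upwards [Ioo_mem_nhdsGT (half_pos ha)] with y hy
    exact (hmono y hy.1 _ (by linarith) hy.2).le
  linarith

lemma pos_of_isPreconnected_of_ne_zero {s : Set ℝ} (hs : IsPreconnected s)
    (hf : ContinuousOn f s) (hne : ∀ x ∈ s, f x ≠ 0) {a : ℝ} (ha : a ∈ s) (hfa : 0 < f a)
    {x : ℝ} (hx : x ∈ s) : 0 < f x := by
  by_contra! h
  obtain ⟨y, hy, hy0⟩ := hs.intermediate_value hx ha hf ⟨h, hfa.le⟩
  exact hne y hy hy0

end Monotonicity

/-- The point where the weighted average `A / ψ` of `p` to the right of `x` equals the weighted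
average `B / m` of `p` to the left of `x` is unique when `p` first decreases and then increases. -/
theorem exists_unique_balance {p w v A ψ B m : ℝ → ℝ}
    (hp : ContinuousOn p (Ioi 0)) (hw : ∀ x > 0, 0 < w x) (hv : ∀ x > 0, 0 < v x)
    (hA : ∀ x > 0, HasDerivAt A (-(w x * p x)) x) (hψ : ∀ x > 0, HasDerivAt ψ (-w x) x)
    (hB : ∀ x > 0, HasDerivAt B (p x * v x) x) (hm : ∀ x > 0, HasDerivAt m (v x) x)
    (hA0 : Tendsto A atTop (𝓝 0)) (hψ0 : Tendsto ψ atTop (𝓝 0))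
    (hB0 : Tendsto B (𝓝[>] 0) (𝓝 0)) (hm0 : Tendsto m (𝓝[>] 0) (𝓝 0))
    {b : ℝ} (hb : 0 < b) (hdec : StrictAntiOn p (Ioo 0 b)) (hinc : StrictMonoOn p (Ici b))
    {s t : ℝ} (hs : s ∈ Ioo 0 b) (hs0 : A s - ψ s * p s = 0)
    (hsu : ∀ x > 0, A x - ψ x * p x = 0 → x = s)
    (ht : b < t) (ht0 : B t - p t * m t = 0) (htu : ∀ x > 0, B x - p x * m x = 0 → x = t) :
    ∃ x, 0 < x ∧ m x * A x = ψ x * B x ∧ (∀ y, 0 < y → m y * A y = ψ y * B y → y = x) ∧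
      s < x ∧ x < t := by
  have hψpos : ∀ x > 0, 0 < ψ x := fun x hx =>
    pos_of_hasDerivAt_neg_of_tendsto_atTop (f' := fun z => -w z)
      (fun z hz => hψ z (hx.trans_le hz)) (fun z hz => neg_lt_zero.2 (hw z (hx.trans hz))) hψ0
  have hmpos : ∀ x > 0, 0 < m x := fun x hx =>
    pos_of_hasDerivAt_pos_of_tendsto_zero hx hm (fun z hz => hv z hz.1) hm0
  have hG : ∀ k, ∀ x > 0, HasDerivAt (fun z => A z - ψ z * k) (-(w x * (p x - k))) x :=
    fun k x hx => ((hA x hx).sub ((hψ x hx).mul_const k)).congr_deriv (by ring)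
  have hK : ∀ k, ∀ x > 0, HasDerivAt (fun z => B z - k * m z) (v x * (p x - k)) x :=
    fun k x hx => ((hB x hx).sub ((hm x hx).const_mul k)).congr_deriv (by ring)
  have hLc : ContinuousOn (fun x => A x - ψ x * p x) (Ioi 0) := fun x hx =>
    (hA x hx).continuousAt.continuousWithinAt.sub
      ((hψ x hx).continuousAt.continuousWithinAt.mul (hp x hx))
  have hHc : ContinuousOn (fun x => B x - p x * m x) (Ioi 0) := fun x hx =>
    (hB x hx).continuousAt.continuousWithinAt.sub
      ((hp x hx).mul (hm x hx).continuousAt.continuousWithinAt)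
  have hs' : 0 < s := hs.1
  have ht' : 0 < t := hb.trans ht
  have hLb : 0 < A b - ψ b * p b :=
    pos_of_hasDerivAt_neg_of_tendsto_atTop (f := fun z => A z - ψ z * p b)
      (fun z hz => hG (p b) z (hb.trans_le hz))
      (fun z hz => neg_lt_zero.2 (mul_pos (hw z (hb.trans hz))
        (sub_pos.2 (hinc self_mem_Ici (mem_Ici_of_Ioi hz) hz))))
      (by simpa using hA0.sub (hψ0.mul_const (p b)))
  have hHs : 0 < B s - p s * m s :=
    pos_of_hasDerivAt_pos_of_tendsto_zero (f := fun z => B z - p s * m z) hs' (hK (p s))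
      (fun z hz => mul_pos (hv z hz.1) (sub_pos.2 (hdec ⟨hz.1, hz.2.trans hs.2⟩ hs hz.2)))
      (by simpa using hB0.sub (hm0.const_mul (p s)))
  have hLpos : ∀ x, s < x → 0 < A x - ψ x * p x := fun x hx =>
    pos_of_isPreconnected_of_ne_zero (f := fun x => A x - ψ x * p x) isPreconnected_Ioi
      (hLc.mono (Ioi_subset_Ioi hs'.le)) (fun y hy h => hy.ne' (hsu y (hs'.trans hy) h)) hs.2 hLb hx
  have hHpos : ∀ x, 0 < x → x < t → 0 < B x - p x * m x := fun x hx hxt =>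
    pos_of_isPreconnected_of_ne_zero (f := fun x => B x - p x * m x) isPreconnected_Ioo
      (hHc.mono Ioo_subset_Ioi_self) (fun y hy h => hy.2.ne (htu y hy.1 h))
      ⟨hs', hs.2.trans ht⟩ hHs ⟨hx, hxt⟩
  have hLneg : ∀ x, 0 < x → x ≤ s → A x - ψ x * p x ≤ 0 := by
    intro x hx hxs
    rcases hxs.eq_or_lt with rfl | hxs
    · exact hs0.le
    have hxb : x ∈ Ioo 0 b := ⟨hx, hxs.trans hs.2⟩
    have h1 := lt_of_hasDerivAt_pos hxs (fun z hz => hG (p x) z (hx.trans_le hz.1))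
      (fun z hz => neg_pos.2 (mul_neg_of_pos_of_neg (hw z (hx.trans hz.1))
        (sub_neg.2 (hdec hxb ⟨hx.trans hz.1, hz.2.trans hs.2⟩ hz.1))))
    have h2 := mul_lt_mul_of_pos_left (hdec hxb hs hxs) (hψpos s hs')
    linarith
  have hHneg : ∀ x, t ≤ x → B x - p x * m x ≤ 0 := by
    intro x htx
    rcases htx.eq_or_lt with rfl | htx
    · exact ht0.le
    have h1 := lt_of_hasDerivAt_pos htx (fun z hz => (hK (p x) z (ht'.trans_le hz.1)).neg)
      (fun z hz => neg_pos.2 (mul_neg_of_pos_of_neg (hv z (ht'.trans hz.1))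
        (sub_neg.2 (hinc (ht.trans hz.1).le (ht.trans htx).le hz.2))))
    have h2 := mul_lt_mul_of_pos_right (hinc ht.le (ht.trans htx).le htx) (hmpos t ht')
    simp only [Pi.neg_apply] at h1
    linarith
  have hD : ∀ x > 0, HasDerivAt (fun z => m z * A z - ψ z * B z)
      (v x * (A x - ψ x * p x) + w x * (B x - p x * m x)) x := fun x hx =>
    (((hm x hx).mul (hA x hx)).sub ((hψ x hx).mul (hB x hx))).congr_deriv (by ring)
  have hD_eq : ∀ x, m x * A x - ψ x * B x =
      m x * (A x - ψ x * p x) - ψ x * (B x - p x * m x) := fun x => by ring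
  have hDneg : ∀ x, 0 < x → x ≤ s → m x * A x - ψ x * B x < 0 := by
    intro x hx hxs
    have h1 := mul_nonpos_of_nonneg_of_nonpos (hmpos x hx).le (hLneg x hx hxs)
    have h2 := mul_pos (hψpos x hx) (hHpos x hx (hxs.trans_lt (hs.2.trans ht)))
    rw [hD_eq]
    linarith
  have hDpos : ∀ x, t ≤ x → 0 < m x * A x - ψ x * B x := by
    intro x htx
    have hx := ht'.trans_le htx
    have h1 := mul_pos (hmpos x hx) (hLpos x ((hs.2.trans ht).trans_le htx))
    have h2 := mul_nonpos_of_nonneg_of_nonpos (hψpos x hx).le (hHneg x htx)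
    rw [hD_eq]
    linarith
  have hDmono : ∀ x y, s < x → x < y → y < t →
      m x * A x - ψ x * B x < m y * A y - ψ y * B y := fun x y hsx hxy hyt =>
    lt_of_hasDerivAt_pos (f := fun z => m z * A z - ψ z * B z) hxy
      (fun z hz => hD z ((hs'.trans hsx).trans_le hz.1)) (fun z hz => by
        have hz0 := (hs'.trans hsx).trans hz.1
        exact add_pos (mul_pos (hv z hz0) (hLpos z (hsx.trans hz.1)))
          (mul_pos (hw z hz0) (hHpos z hz0 (hz.2.trans hyt))))
  have hloc : ∀ y, 0 < y → m y * A y = ψ y * B y → s < y ∧ y < t := fun y hy h =>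
    ⟨lt_of_not_ge fun hys => (hDneg y hy hys).ne (sub_eq_zero.2 h),
      lt_of_not_ge fun hty => (hDpos y hty).ne' (sub_eq_zero.2 h)⟩
  obtain ⟨x, hx, hx0⟩ := intermediate_value_Icc (hs.2.trans ht).le
    (f := fun z => m z * A z - ψ z * B z)
    (fun z hz => (hD z (hs'.trans_le hz.1)).continuousAt.continuousWithinAt)
    ⟨(hDneg s hs' le_rfl).le, (hDpos t le_rfl).le⟩
  have hxpos := hs'.trans_le hx.1
  have hxe := sub_eq_zero.1 hx0
  have hxl := hloc x hxpos hxe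
  refine ⟨x, hxpos, hxe, fun y hy hye => ?_, hxl⟩
  have hyl := hloc y hy hye
  rcases lt_trichotomy y x with h | h | h
  · have := hDmono y x hyl.1 h hxl.2
    linarith
  · exact h
  · have := hDmono x y hxl.1 h hyl.2
    linarith

/-- A first derivative divided by the scale density has as derivative the speed density times the
generator of the diffusion. -/
lemma hasDerivAt_div_scale {μ σ S' f' : ℝ → ℝ} {c f'' x : ℝ} (hc : 0 < c)
    (hμ : ContinuousOn μ (Ioi 0)) (hσc : ContinuousOn σ (Ioi 0)) (hσ : ∀ x > 0, 0 < σ x)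
    (hS' : ∀ x > 0, S' x = Real.exp (-(∫ z in c..x, 2 * μ z / σ z ^ 2)))
    (hx : 0 < x) (hf' : HasDerivAt f' f'' x) :
    HasDerivAt (fun z => f' z / S' z)
      (2 / (σ x ^ 2 * S' x) * (μ x * f' x + σ x ^ 2 / 2 * f'')) x := by
  have hcont : ContinuousOn (fun z => 2 * μ z / σ z ^ 2) (Ioi 0) :=
    (continuousOn_const.mul hμ).div (hσc.pow 2) fun z hz => (pow_pos (hσ z hz) 2).ne'
  have hint : IntervalIntegrable (fun z => 2 * μ z / σ z ^ 2) volume c x :=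
    (hcont.mono fun z hz => (lt_min hc hx).trans_le hz.1).intervalIntegrable
  have hI := (intervalIntegral.integral_hasDerivAt_right hint
    (hcont.stronglyMeasurableAtFilter isOpen_Ioi x hx)
    (hcont.continuousAt (Ioi_mem_nhds hx))).neg.exp
  have hSd : HasDerivAt S' (S' x * -(2 * μ x / σ x ^ 2)) x := by
    refine (hI.congr_of_eventuallyEq ?_).congr_deriv ?_
    · filter_upwards [Ioi_mem_nhds hx] with y hy using hS' y hy
    · rw [hS' x hx]; rfl
  have hSne : S' x ≠ 0 := by rw [hS' x hx]; positivity
  have hσne := (hσ x hx).ne'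
  refine (hf'.div hSd hSne).congr_deriv ?_
  field_simp
  ring

/-- The equation S'(x) m(0,x) L(x) = −φ_λ'(x) H(0,x) has a unique
    solution x̄ in (0,∞), and x̄ ∈ (x̃, x̂), where x̃ ∈ (0,x*) is the unique root of L
    and x̂ ∈ (x*,∞) is the unique root of x ↦ H(0,x). -/
theorem stmt_4
    (μ σ pf : ℝ → ℝ) (c : ℝ) (hc : 0 < c)
    (hμc : ContinuousOn μ (Set.Ioi 0)) (hσc : ContinuousOn σ (Set.Ioi 0))
    (hσ : ∀ x > 0, 0 < σ x)
    (S' m' : ℝ → ℝ)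
    (hS'def : ∀ x > 0, S' x = Real.exp (-(∫ z in c..x, 2 * μ z / σ z ^ 2)))
    (hm'def : ∀ x > 0, m' x = 2 / (σ x ^ 2 * S' x))
    (m0 : ℝ → ℝ) (hm0def : ∀ x > 0, m0 x = ∫ z in Set.Ioc 0 x, m' z)
    (lam : ℝ) (hlam : 0 < lam)
    (φ φ' φ'' : ℝ → ℝ)
    (hφd : ∀ x > 0, HasDerivAt φ (φ' x) x)
    (hφd2 : ∀ x > 0, HasDerivAt φ' (φ'' x) x)
    (hφ''c : ContinuousOn φ'' (Set.Ioi 0))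
    (hφpos : ∀ x > 0, 0 < φ x)
    (hφanti : StrictAntiOn φ (Set.Ioi 0))
    (hode : ∀ x > 0, μ x * φ' x + σ x ^ 2 / 2 * φ'' x = lam * φ x)
    (hpfc : ContinuousOn pf (Set.Ioi 0)) (hpfnn : ∀ x > 0, 0 ≤ pf x)
    (γ : ℝ) (hγ : 0 < γ)
    (pmu : ℝ → ℝ) (hpmudef : ∀ x > 0, pmu x = pf x + γ * μ x)
    (L : ℝ → ℝ)
    (hLdef : ∀ x > 0,
      L x = lam * (∫ z in Set.Ioi x, pmu z * φ z * m' z) + φ' x / S' x * pmu x)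
    (H : ℝ → ℝ)
    (hHdef : ∀ x > 0, H x = (∫ z in Set.Ioc 0 x, pmu z * m' z) - pmu x * m0 x)
    (xstar : ℝ) (hxstar : 0 < xstar)
    (hdec : StrictAntiOn pmu (Set.Ioo 0 xstar))
    (hinc : StrictMonoOn pmu (Set.Ici xstar))
    (hlimpos : ∃ ε > 0, ∀ᶠ x in atTop, ε ≤ pmu x)
    (hmi : ∀ y > 0, IntegrableOn m' (Set.Ioc 0 y))
    (hpmi : ∀ y > 0, IntegrableOn (fun z => pmu z * m' z) (Set.Ioc 0 y))
    (hφi : ∀ x > 0, IntegrableOn (fun z => φ z * m' z) (Set.Ioi x))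
    (hpφi : ∀ x > 0, IntegrableOn (fun z => pmu z * φ z * m' z) (Set.Ioi x))
    (hS0 : Tendsto S' (nhdsWithin 0 (Set.Ioi 0)) atTop)
    (hφ0 : Tendsto φ (nhdsWithin 0 (Set.Ioi 0)) atTop)
    (hφS0 : Tendsto (fun x => φ' x / S' x) (nhdsWithin 0 (Set.Ioi 0)) atBot)
    (hφtop : Tendsto φ atTop (nhds 0))
    (hφStop : Tendsto (fun x => φ' x / S' x) atTop (nhds 0))
    (xt : ℝ) (hxt : xt ∈ Set.Ioo 0 xstar) (hLxt : L xt = 0)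
    (hxtu : ∀ x > 0, L x = 0 → x = xt)
    (xh : ℝ) (hxh : xh ∈ Set.Ioi xstar) (hHxh : H xh = 0)
    (hxhu : ∀ x > 0, H x = 0 → x = xh) :
    ∃ xb : ℝ, 0 < xb ∧ S' xb * m0 xb * L xb = -(φ' xb * H xb) ∧
      (∀ y, 0 < y → S' y * m0 y * L y = -(φ' y * H y) → y = xb) ∧
      xt < xb ∧ xb < xh := by
  have hSpos : ∀ x > 0, 0 < S' x := fun x hx => by rw [hS'def x hx]; exact Real.exp_pos _
  have hmpos : ∀ x > 0, 0 < m' x := fun x hx => by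
    have := hSpos x hx
    have := hσ x hx
    rw [hm'def x hx]; positivity
  have hSc : ContinuousOn S' (Ioi 0) := by
    have h1 : ContinuousOn (fun z => 1 / S' z) (Ioi 0) := fun x hx =>
      (hasDerivAt_div_scale (f' := fun _ => 1) hc hμc hσc hσ hS'def hx
        (hasDerivAt_const x 1)).continuousAt.continuousWithinAt
    exact (h1.inv₀ fun x hx => (one_div_pos.2 (hSpos x hx)).ne').congr fun x _ => by simp
  have hm'c : ContinuousOn m' (Ioi 0) :=
    (continuousOn_const.div ((hσc.pow 2).mul hSc) fun x hx =>
      (mul_pos (pow_pos (hσ x hx) 2) (hSpos x hx)).ne').congr hm'def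
  have hφc : ContinuousOn φ (Ioi 0) := fun x hx => (hφd x hx).continuousAt.continuousWithinAt
  have hpc : ContinuousOn pmu (Ioi 0) := (hpfc.add (continuousOn_const.mul hμc)).congr hpmudef
  have hψ : ∀ x > 0, HasDerivAt (fun z => -(φ' z / S' z)) (-(lam * φ x * m' x)) x :=
    fun x hx => (hasDerivAt_div_scale hc hμc hσc hσ hS'def hx (hφd2 x hx)).neg.congr_deriv
      (by rw [hode x hx, hm'def x hx]; ring)
  have hA : ∀ x > 0, HasDerivAt (fun y => lam * ∫ z in Ioi y, pmu z * φ z * m' z)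
      (-(lam * φ x * m' x * pmu x)) x := fun x hx =>
    ((hasDerivAt_setIntegral_Ioi ((hpc.mul hφc).mul hm'c) hpφi hx).const_mul lam).congr_deriv
      (by simp only [Pi.mul_apply]; ring)
  have hm0 : ∀ x > 0, HasDerivAt m0 (m' x) x := fun x hx =>
    (hasDerivAt_setIntegral_Ioc_zero hm'c hmi hx).congr_of_eventuallyEq <| by
      filter_upwards [Ioi_mem_nhds hx] with y hy using hm0def y hy
  have hLeq : ∀ x > 0, L x = lam * (∫ z in Ioi x, pmu z * φ z * m' z)
      - -(φ' x / S' x) * pmu x := fun x hx => by rw [hLdef x hx]; ring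
  have hEq : ∀ x > 0, S' x * m0 x * L x = -(φ' x * H x) ↔
      m0 x * (lam * ∫ z in Ioi x, pmu z * φ z * m' z) =
        -(φ' x / S' x) * ∫ z in Ioc 0 x, pmu z * m' z := fun x hx => by
    have hSne := (hSpos x hx).ne'
    rw [hLdef x hx, hHdef x hx, ← mul_right_inj' hSne (a := S' x)
      (b := m0 x * (lam * ∫ z in Ioi x, pmu z * φ z * m' z))]
    have h1 : S' x * (φ' x / S' x) = φ' x := mul_div_cancel₀ _ hSne
    constructor <;> intro h
    · linear_combination h + (-(m0 x * pmu x) + ∫ z in Ioc 0 x, pmu z * m' z) * h1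
    · linear_combination h + (m0 x * pmu x - ∫ z in Ioc 0 x, pmu z * m' z) * h1
  obtain ⟨x, hx, hxe, hxu, hxs⟩ := exists_unique_balance hpc
    (fun x hx => mul_pos (mul_pos hlam (hφpos x hx)) (hmpos x hx)) hmpos hA hψ
    (fun x hx => hasDerivAt_setIntegral_Ioc_zero (hpc.mul hm'c) hpmi hx) hm0
    (by simpa using (tendsto_setIntegral_Ioi_atTop (hpφi 1 one_pos)).const_mul lam)
    (by simpa using hφStop.neg)
    (tendsto_setIntegral_Ioc_zero (hpmi 1 one_pos))
    ((tendsto_setIntegral_Ioc_zero (hmi 1 one_pos)).congr' <| by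
      filter_upwards [self_mem_nhdsWithin] with y hy using (hm0def y hy).symm)
    hxstar hdec hinc hxt ((hLeq xt hxt.1).symm.trans hLxt)
    (fun x hx h => hxtu x hx ((hLeq x hx).trans h)) hxh
    ((hHdef xh (hxstar.trans hxh)).symm.trans hHxh)
    (fun x hx h => hxhu x hx ((hHdef x hx).trans h))
  exact ⟨x, hx, (hEq x hx).2 hxe, fun y hy hye => hxu y hy ((hEq y hy).1 hye), hxs⟩
end

section
/- For every x > 0, S'(x) m(0,x) L(x) + φ_λ'(x) H(0,x) = 0 if and only if (∫_x^∞ π_μ(z) φ_λ(z) m'(z) dz) / (∫_x^∞ φ_λ(z) m'(z) dz) = (∫_0^x π_μ(z) m'(z) dz) / m(0,x). -/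
open MeasureTheory Filter

/-- The density `exp (-∫_c^x g)` solves `s' = -g s`. -/
theorem hasDerivAt_exp_neg_intervalIntegral {g s : ℝ → ℝ} {c x : ℝ} (hc : 0 < c) (hx : 0 < x)
    (hg : ContinuousOn g (Set.Ioi 0))
    (hs : ∀ y > 0, s y = Real.exp (-(∫ z in c..y, g z))) :
    HasDerivAt s (-g x * s x) x := by
  have hint : IntervalIntegrable g volume c x :=
    (hg.mono fun z hz => (lt_min hc hx).trans_le hz.1).intervalIntegrable
  have hd : HasDerivAt (fun y => ∫ z in c..y, g z) (g x) x :=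
    intervalIntegral.integral_hasDerivAt_right hint
      (hg.stronglyMeasurableAtFilter isOpen_Ioi x hx) (hg.continuousAt (Ioi_mem_nhds hx))
  have he := hd.neg.exp
  rw [hs x hx, mul_comm]
  exact he.congr_of_eventuallyEq (by filter_upwards [Ioi_mem_nhds hx] with y hy using hs y hy)

theorem setIntegral_pos_of_forall_pos {f : ℝ → ℝ} {s : Set ℝ} (hs : MeasurableSet s)
    (hvol : 0 < volume s) (hf : ∀ x ∈ s, 0 < f x) (hfi : IntegrableOn f s) :
    0 < ∫ x in s, f x := by
  rw [setIntegral_pos_iff_support_of_nonneg_ae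
    ((ae_restrict_mem hs).mono fun x hx => (hf x hx).le) hfi,
    Set.inter_eq_right.mpr fun x hx => Function.mem_support.mpr (hf x hx).ne']
  exact hvol

/-- For every x > 0, S'(x) m(0,x) L(x) + φ_λ'(x) H(0,x) = 0 iff
    (∫_x^∞ π_μ φ_λ m') / (∫_x^∞ φ_λ m') = (∫_0^x π_μ m') / m(0,x). -/
theorem stmt_5
    (μ σ pf : ℝ → ℝ) (c : ℝ) (hc : 0 < c)
    (hμc : ContinuousOn μ (Set.Ioi 0)) (hσc : ContinuousOn σ (Set.Ioi 0))
    (hσ : ∀ x > 0, 0 < σ x)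
    (S' m' : ℝ → ℝ)
    (hS'def : ∀ x > 0, S' x = Real.exp (-(∫ z in c..x, 2 * μ z / σ z ^ 2)))
    (hm'def : ∀ x > 0, m' x = 2 / (σ x ^ 2 * S' x))
    (m0 : ℝ → ℝ) (hm0def : ∀ x > 0, m0 x = ∫ z in Set.Ioc 0 x, m' z)
    (lam : ℝ) (hlam : 0 < lam)
    (φ φ' φ'' : ℝ → ℝ)
    (hφd : ∀ x > 0, HasDerivAt φ (φ' x) x)
    (hφd2 : ∀ x > 0, HasDerivAt φ' (φ'' x) x)
    (hφ''c : ContinuousOn φ'' (Set.Ioi 0))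
    (hφpos : ∀ x > 0, 0 < φ x)
    (hφanti : StrictAntiOn φ (Set.Ioi 0))
    (hode : ∀ x > 0, μ x * φ' x + σ x ^ 2 / 2 * φ'' x = lam * φ x)
    (hpfc : ContinuousOn pf (Set.Ioi 0)) (hpfnn : ∀ x > 0, 0 ≤ pf x)
    (γ : ℝ) (hγ : 0 < γ)
    (pmu : ℝ → ℝ) (hpmudef : ∀ x > 0, pmu x = pf x + γ * μ x)
    (L : ℝ → ℝ)
    (hLdef : ∀ x > 0,
      L x = lam * (∫ z in Set.Ioi x, pmu z * φ z * m' z) + φ' x / S' x * pmu x)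
    (H : ℝ → ℝ)
    (hHdef : ∀ x > 0, H x = (∫ z in Set.Ioc 0 x, pmu z * m' z) - pmu x * m0 x)
    (hmi : ∀ y > 0, IntegrableOn m' (Set.Ioc 0 y))
    (hpmi : ∀ y > 0, IntegrableOn (fun z => pmu z * m' z) (Set.Ioc 0 y))
    (hφi : ∀ x > 0, IntegrableOn (fun z => φ z * m' z) (Set.Ioi x))
    (hpφi : ∀ x > 0, IntegrableOn (fun z => pmu z * φ z * m' z) (Set.Ioi x))
    (hφStop : Tendsto (fun x => φ' x / S' x) atTop (nhds 0)) :
    ∀ x > 0,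
      (S' x * m0 x * L x + φ' x * H x = 0 ↔
        (∫ z in Set.Ioi x, pmu z * φ z * m' z) / (∫ z in Set.Ioi x, φ z * m' z)
          = (∫ z in Set.Ioc 0 x, pmu z * m' z) / m0 x) := by
  intro x hx
  have hSpos : ∀ y > 0, 0 < S' y := fun y hy => by rw [hS'def y hy]; exact Real.exp_pos _
  have hmpos : ∀ y > 0, 0 < m' y := fun y hy => by
    rw [hm'def y hy]
    have := hσ y hy
    have := hSpos y hy
    positivity
  have hgc : ContinuousOn (fun z => 2 * μ z / σ z ^ 2) (Set.Ioi 0) :=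
    (continuousOn_const.mul hμc).div (hσc.pow 2) fun z hz => (pow_pos (hσ z hz) 2).ne'
  have hderiv : ∀ y ∈ Set.Ici x,
      HasDerivAt (fun z => φ' z / S' z) (lam * (φ y * m' y)) y := by
    intro y hy
    have hy0 : 0 < y := hx.trans_le hy
    have hS := (hSpos y hy0).ne'
    have hσy := (hσ y hy0).ne'
    refine ((hφd2 y hy0).div
      (hasDerivAt_exp_neg_intervalIntegral hc hy0 hgc hS'def) hS).congr_deriv ?_
    rw [hm'def y hy0]
    field_simp
    linear_combination 2 * hode y hy0
  have hflux : φ' x / S' x = -(lam * ∫ z in Set.Ioi x, φ z * m' z) := by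
    have h := integral_Ioi_of_hasDerivAt_of_tendsto' hderiv ((hφi x hx).const_mul lam) hφStop
    rw [integral_const_mul] at h
    linarith
  have hm0pos : 0 < m0 x := by
    rw [hm0def x hx]
    exact setIntegral_pos_of_forall_pos measurableSet_Ioc (by simpa using hx)
      (fun z hz => hmpos z hz.1) (hmi x hx)
  have hφmpos : 0 < ∫ z in Set.Ioi x, φ z * m' z :=
    setIntegral_pos_of_forall_pos measurableSet_Ioi (by simp)
      (fun z hz => mul_pos (hφpos z (hx.trans hz)) (hmpos z (hx.trans hz))) (hφi x hx)
  have hS := hSpos x hx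
  have hφ' : φ' x = -(lam * ∫ z in Set.Ioi x, φ z * m' z) * S' x := (div_eq_iff hS.ne').mp hflux
  have key : S' x * m0 x * L x + φ' x * H x =
      lam * S' x * ((∫ z in Set.Ioi x, pmu z * φ z * m' z) * m0 x -
        (∫ z in Set.Ioc 0 x, pmu z * m' z) * ∫ z in Set.Ioi x, φ z * m' z) := by
    rw [hLdef x hx, hHdef x hx, hflux, hφ']
    ring
  rw [key, div_eq_div_iff hφmpos.ne' hm0pos.ne', mul_eq_zero,
    or_iff_right (mul_pos hlam hS).ne', sub_eq_zero]
end

section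
/- For all fixed 0 < x < z, the ratio φ_λ(z)/φ_λ(x) tends to 0 as λ → ∞. -/
open MeasureTheory Filter

/-- If `f' ≤ 0` and `f'' ≥ K f' + A` on `[x, z]`, then `f x` exceeds `f z` by an amount
proportional to `A`. -/
lemma add_mul_sq_le_of_second_deriv_ge {f f' f'' : ℝ → ℝ} {x z K A : ℝ}
    (hx : 0 ≤ x) (hxz : x ≤ z) (hK : 0 ≤ K) (hA : 0 ≤ A)
    (hf : ∀ y ∈ Set.Icc x z, HasDerivAt f (f' y) y)
    (hf' : ∀ y ∈ Set.Icc x z, HasDerivAt f' (f'' y) y)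
    (hnonpos : ∀ y ∈ Set.Icc x z, f' y ≤ 0)
    (hge : ∀ y ∈ Set.Icc x z, K * f' y + A ≤ f'' y) :
    f z + A * Real.exp (-(K * z)) * ((z - x) ^ 2 / 2) ≤ f x := by
  set B := A * Real.exp (-(K * z))
  have hd1 : ∀ y ∈ Set.Icc x z, HasDerivAt (fun y => Real.exp (-(K * y)) * f' y - B * y)
      (Real.exp (-(K * y)) * (f'' y - K * f' y) - B) y := by
    intro y hy
    have he : HasDerivAt (fun y => Real.exp (-(K * y))) (Real.exp (-(K * y)) * (-(K * 1))) y :=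
      (((hasDerivAt_id y).const_mul K).neg).exp
    refine ((he.mul (hf' y hy)).sub ((hasDerivAt_id y).const_mul B)).congr_deriv ?_
    ring
  have hmono : MonotoneOn (fun y => Real.exp (-(K * y)) * f' y - B * y) (Set.Icc x z) := by
    refine monotoneOn_of_hasDerivWithinAt_nonneg (convex_Icc x z)
      (fun y hy => (hd1 y hy).continuousAt.continuousWithinAt)
      (fun y hy => (hd1 y (interior_subset hy)).hasDerivWithinAt) fun y hy => ?_
    have hy' := interior_subset hy
    have h1 : Real.exp (-(K * z)) ≤ Real.exp (-(K * y)) :=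
      Real.exp_le_exp.2 (neg_le_neg (mul_le_mul_of_nonneg_left hy'.2 hK))
    have h2 : A ≤ f'' y - K * f' y := by linarith [hge y hy']
    have h3 := mul_le_mul h1 h2 hA (Real.exp_pos _).le
    linarith
  have hf'_le : ∀ y ∈ Set.Icc x z, f' y ≤ -(B * (z - y)) := by
    intro y hy
    have h1 := hmono hy (Set.right_mem_Icc.2 hxz) hy.2
    have h2 : Real.exp (-(K * z)) * f' z ≤ 0 :=
      mul_nonpos_of_nonneg_of_nonpos (Real.exp_pos _).le (hnonpos z (Set.right_mem_Icc.2 hxz))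
    have h3 : Real.exp (-(K * y)) * f' y ≤ -(B * (z - y)) := by
      simp only at h1
      linarith
    have h5 : Real.exp (-(K * y)) ≤ 1 :=
      Real.exp_le_one_iff.2 (neg_nonpos.2 (mul_nonneg hK (hx.trans hy.1)))
    linarith [mul_nonneg (sub_nonneg.2 h5) (neg_nonneg.2 (hnonpos y hy))]
  have hd2 : ∀ y ∈ Set.Icc x z, HasDerivAt (fun y => f y - B * ((z - y) ^ 2 / 2))
      (f' y + B * (z - y)) y := by
    intro y hy
    refine ((hf y hy).sub
      (((((hasDerivAt_id y).const_sub z).pow 2).div_const 2).const_mul B)).congr_deriv ?_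
    simp
    ring
  have hanti : AntitoneOn (fun y => f y - B * ((z - y) ^ 2 / 2)) (Set.Icc x z) :=
    antitoneOn_of_hasDerivWithinAt_nonpos (convex_Icc x z)
      (fun y hy => (hd2 y hy).continuousAt.continuousWithinAt)
      (fun y hy => (hd2 y (interior_subset hy)).hasDerivWithinAt)
      fun y hy => by linarith [hf'_le y (interior_subset hy)]
  have h := hanti (Set.left_mem_Icc.2 hxz) (Set.right_mem_Icc.2 hxz) hxz
  simp only [sub_self] at h
  linarith

/-- For all fixed 0 < x < z, the ratio φ_λ(z)/φ_λ(x) tends to 0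
    as λ → ∞. -/
theorem stmt_12
    (μ σ : ℝ → ℝ) (c : ℝ) (hc : 0 < c)
    (hμc : ContinuousOn μ (Set.Ioi 0)) (hσc : ContinuousOn σ (Set.Ioi 0))
    (hσ : ∀ x > 0, 0 < σ x)
    (S' : ℝ → ℝ)
    (hS'def : ∀ x > 0, S' x = Real.exp (-(∫ z in c..x, 2 * μ z / σ z ^ 2)))
    (φ φ' φ'' : ℝ → ℝ → ℝ)
    (hφd : ∀ lam > 0, ∀ x > 0, HasDerivAt (φ lam) (φ' lam x) x)
    (hφd2 : ∀ lam > 0, ∀ x > 0, HasDerivAt (φ' lam) (φ'' lam x) x)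
    (hφ''c : ∀ lam > 0, ContinuousOn (φ'' lam) (Set.Ioi 0))
    (hφpos : ∀ lam > 0, ∀ x > 0, 0 < φ lam x)
    (hφanti : ∀ lam > 0, StrictAntiOn (φ lam) (Set.Ioi 0))
    (hode : ∀ lam > 0, ∀ x > 0,
      μ x * φ' lam x + σ x ^ 2 / 2 * φ'' lam x = lam * φ lam x)
    (hφ0 : ∀ lam > 0, Tendsto (φ lam) (nhdsWithin 0 (Set.Ioi 0)) atTop)
    (hφStop : ∀ lam > 0, Tendsto (fun x => φ' lam x / S' x) atTop (nhds 0)) :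
    ∀ x z : ℝ, 0 < x → x < z →
      Tendsto (fun lam => φ lam z / φ lam x) atTop (nhds 0) := by
  intro x z hx hxz
  have hpos : ∀ y ∈ Set.Icc x z, 0 < y := fun y hy => hx.trans_le hy.1
  have hsub : Set.Icc x z ⊆ Set.Ioi 0 := hpos
  have hσ0 : ∀ y ∈ Set.Icc x z, σ y ^ 2 ≠ 0 := fun y hy => (pow_pos (hσ y (hpos y hy)) 2).ne'
  have hσ2 : ContinuousOn (fun y => σ y ^ 2) (Set.Icc x z) := (hσc.mono hsub).pow 2
  obtain ⟨K, hK⟩ := isCompact_Icc.exists_bound_of_continuousOn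
    (((hμc.mono hsub).const_smul (2 : ℝ)).div hσ2 hσ0)
  obtain ⟨M, hM⟩ := isCompact_Icc.exists_bound_of_continuousOn hσ2
  have hxmem : x ∈ Set.Icc x z := Set.left_mem_Icc.2 hxz.le
  have hK0 : 0 ≤ K := (norm_nonneg _).trans (hK x hxmem)
  have hM0 : 0 < M := (norm_pos_iff.2 (hσ0 x hxmem)).trans_le (hM x hxmem)
  set C := 2 / M * Real.exp (-(K * z)) * ((z - x) ^ 2 / 2) with hC
  have hC0 : 0 < C := by
    have : 0 < z - x := sub_pos.2 hxz
    positivity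
  have hderiv : ∀ lam > 0, ∀ y > 0, φ' lam y ≤ 0 := by
    intro lam hl y hy
    rw [← (hφd lam hl y hy).deriv, ← derivWithin_of_isOpen isOpen_Ioi hy]
    exact (hφanti lam hl).antitoneOn.derivWithin_nonpos
  have hbound : ∀ lam > 0, φ lam z / φ lam x ≤ 1 / (lam * C) := by
    intro lam hl
    have hz := hφpos lam hl z (hx.trans hxz)
    have key := add_mul_sq_le_of_second_deriv_ge (A := lam * φ lam z * (2 / M))
      hx.le hxz.le hK0 (by positivity)
      (fun y hy => hφd lam hl y (hpos y hy)) (fun y hy => hφd2 lam hl y (hpos y hy))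
      (fun y hy => hderiv lam hl y (hpos y hy)) ?_
    · rw [div_le_div_iff₀ (hφpos lam hl x hx) (by positivity)]
      calc φ lam z * (lam * C)
          = lam * φ lam z * (2 / M) * Real.exp (-(K * z)) * ((z - x) ^ 2 / 2) := by
            rw [hC]; ring
        _ ≤ 1 * φ lam x := by linarith
    · intro y hy
      have hy0 := hpos y hy
      have hs : 0 < σ y ^ 2 := pow_pos (hσ y hy0) 2
      have heq : φ'' lam y
          = -(2 * μ y / σ y ^ 2 * φ' lam y) + lam * φ lam y * (2 / σ y ^ 2) := by
        have := hode lam hl y hy0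
        field_simp
        rw [eq_div_iff hs.ne']
        linarith
      have hle : -(2 * μ y / σ y ^ 2) ≤ K := (neg_le_abs _).trans (hK y hy)
      have h1 : K * φ' lam y ≤ -(2 * μ y / σ y ^ 2) * φ' lam y :=
        mul_le_mul_of_nonpos_right hle (hderiv lam hl y hy0)
      have h2 : lam * φ lam z * (2 / M) ≤ lam * φ lam y * (2 / σ y ^ 2) := by
        have hzy : φ lam z ≤ φ lam y :=
          (hφanti lam hl).antitoneOn hy0 (hx.trans hxz) hy.2
        have hsM : σ y ^ 2 ≤ M := (le_abs_self _).trans (hM y hy)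
        have := hφpos lam hl y hy0
        gcongr
      linarith
  refine squeeze_zero' ?_ ?_ (g := fun lam => 1 / (lam * C)) ?_
  · filter_upwards [eventually_gt_atTop 0] with lam hl
    exact (div_pos (hφpos lam hl z (hx.trans hxz)) (hφpos lam hl x hx)).le
  · filter_upwards [eventually_gt_atTop 0] with lam hl using hbound lam hl
  · exact tendsto_const_nhds.div_atTop (tendsto_id.atTop_mul_const hC0)
end

section
/- For all 0 < x < z and all 0 < λ ≤ λ̂, φ_λ̂(z)/φ_λ̂(x) ≤ φ_λ(z)/φ_λ(x); that is, for fixed x < z the ratio φ_λ(z)/φ_λ(x) is nonincreasing in λ. -/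
open MeasureTheory Filter

/-- The scale density `exp (-∫_c^x h)` solves `T' = -h T`. -/
theorem hasDerivAt_exp_neg_integral {h : ℝ → ℝ} {c x : ℝ} (hc : 0 < c) (hx : 0 < x)
    (hh : ContinuousOn h (Set.Ioi 0)) :
    HasDerivAt (fun y => Real.exp (-(∫ z in c..y, h z)))
      (-h x * Real.exp (-(∫ z in c..x, h z))) x := by
  have hsub : Set.uIcc c x ⊆ Set.Ioi 0 := fun y hy =>
    lt_of_lt_of_le (lt_min hc hx) hy.1
  have hint : HasDerivAt (fun y => ∫ z in c..y, h z) (h x) x :=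
    intervalIntegral.integral_hasDerivAt_right (hh.mono hsub).intervalIntegrable
      (hh.stronglyMeasurableAtFilter isOpen_Ioi x hx) (hh.continuousAt (Ioi_mem_nhds hx))
  simpa [mul_comm] using hint.neg.exp

/-- A positive function decreasing on `(0, ∞)` is bounded at infinity, so its product with a
function vanishing at infinity vanishes at infinity. -/
theorem tendsto_mul_zero_of_antitoneOn_pos {f u : ℝ → ℝ} (hf : AntitoneOn f (Set.Ioi 0))
    (hpos : ∀ x > 0, 0 < f x) (hu : Tendsto u atTop (nhds 0)) :
    Tendsto (fun x => u x * f x) atTop (nhds 0) := by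
  refine hu.zero_mul_isBoundedUnder_le ⟨f 1, ?_⟩
  rw [eventually_map]
  filter_upwards [eventually_ge_atTop (1 : ℝ)] with x hx
  have hx0 : 0 < x := by linarith
  simpa [abs_of_pos (hpos x hx0)] using hf (Set.mem_Ioi.2 one_pos) hx0 hx

/-- If `f` and `g` are positive decreasing solutions of `m u' + (s² / 2) u'' = l u` with rates
`l ≤ l'` whose derivatives vanish at infinity relative to a scale density `T`, then their
Wronskian is nonpositive. -/
theorem wronskian_nonpos {m s T f f' f'' g g' g'' : ℝ → ℝ} {l l' : ℝ} (hl : l ≤ l')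
    (hs : ∀ x > 0, 0 < s x) (hT : ∀ x > 0, 0 < T x)
    (hTd : ∀ x > 0, HasDerivAt T (-(2 * m x / s x ^ 2) * T x) x)
    (hf : ∀ x > 0, HasDerivAt f (f' x) x) (hf' : ∀ x > 0, HasDerivAt f' (f'' x) x)
    (hg : ∀ x > 0, HasDerivAt g (g' x) x) (hg' : ∀ x > 0, HasDerivAt g' (g'' x) x)
    (hfpos : ∀ x > 0, 0 < f x) (hgpos : ∀ x > 0, 0 < g x)
    (hfanti : AntitoneOn f (Set.Ioi 0)) (hganti : AntitoneOn g (Set.Ioi 0))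
    (hfode : ∀ x > 0, m x * f' x + s x ^ 2 / 2 * f'' x = l * f x)
    (hgode : ∀ x > 0, m x * g' x + s x ^ 2 / 2 * g'' x = l' * g x)
    (hftop : Tendsto (fun x => f' x / T x) atTop (nhds 0))
    (hgtop : Tendsto (fun x => g' x / T x) atTop (nhds 0)) {x : ℝ} (hx : 0 < x) :
    g' x * f x - g x * f' x ≤ 0 := by
  set W : ℝ → ℝ := fun y => (g' y * f y - g y * f' y) / T y with hW
  have hWd : ∀ y > 0, HasDerivAt W (2 / s y ^ 2 * (l' - l) * (f y * g y) / T y) y := by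
    intro y hy
    have hsy := (hs y hy).ne'
    have hTy := (hT y hy).ne'
    have hfy : f'' y = 2 / s y ^ 2 * (l * f y - m y * f' y) := by
      rw [← hfode y hy]; field_simp; ring
    have hgy : g'' y = 2 / s y ^ 2 * (l' * g y - m y * g' y) := by
      rw [← hgode y hy]; field_simp; ring
    refine ((((hg' y hy).mul (hf y hy)).sub ((hg y hy).mul (hf' y hy))).div (hTd y hy)
      hTy).congr_deriv ?_
    simp only [Pi.mul_apply, Pi.sub_apply, hfy, hgy]
    field_simp
    ring
  have hmono : MonotoneOn W (Set.Ioi 0) := by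
    refine monotoneOn_of_hasDerivWithinAt_nonneg (convex_Ioi 0)
      (fun y hy => (hWd y hy).continuousAt.continuousWithinAt)
      (fun y hy => (hWd y (interior_subset hy)).hasDerivWithinAt) fun y hy => ?_
    have hy0 : 0 < y := interior_subset hy
    have := hfpos y hy0
    have := hgpos y hy0
    have := hT y hy0
    have := sub_nonneg.2 hl
    positivity
  have hlim : Tendsto W atTop (nhds 0) := by
    have h := (tendsto_mul_zero_of_antitoneOn_pos hfanti hfpos hgtop).sub
      (tendsto_mul_zero_of_antitoneOn_pos hganti hgpos hftop)
    rw [sub_zero] at h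
    refine h.congr fun y => ?_
    simp only [hW]
    ring
  have hWx : W x ≤ 0 := by
    refine ge_of_tendsto hlim ?_
    filter_upwards [eventually_ge_atTop x] with y hy
    exact hmono hx (hx.trans_le hy) hy
  simpa using (div_le_iff₀ (hT x hx)).1 hWx

/-- If the Wronskian of `f` and `g` is nonpositive, then `g / f` is decreasing. -/
theorem antitoneOn_div_of_wronskian_nonpos {f f' g g' : ℝ → ℝ}
    (hf : ∀ x > 0, HasDerivAt f (f' x) x) (hg : ∀ x > 0, HasDerivAt g (g' x) x)
    (hfpos : ∀ x > 0, 0 < f x) (hW : ∀ x > 0, g' x * f x - g x * f' x ≤ 0) :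
    AntitoneOn (fun x => g x / f x) (Set.Ioi 0) := by
  have hd : ∀ y > 0, HasDerivAt (fun x => g x / f x)
      ((g' y * f y - g y * f' y) / f y ^ 2) y := fun y hy =>
    (hg y hy).div (hf y hy) (hfpos y hy).ne'
  exact antitoneOn_of_hasDerivWithinAt_nonpos (convex_Ioi 0)
    (fun y hy => (hd y hy).continuousAt.continuousWithinAt)
    (fun y hy => (hd y (interior_subset hy)).hasDerivWithinAt)
    fun y hy => div_nonpos_of_nonpos_of_nonneg (hW y (interior_subset hy)) (sq_nonneg _)

/-- For all 0 < x < z and 0 < λ ≤ λ̂,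
    φ_λ̂(z)/φ_λ̂(x) ≤ φ_λ(z)/φ_λ(x); i.e., for fixed x < z the ratio
    φ_λ(z)/φ_λ(x) is nonincreasing in λ. -/
theorem stmt_13
    (μ σ : ℝ → ℝ) (c : ℝ) (hc : 0 < c)
    (hμc : ContinuousOn μ (Set.Ioi 0)) (hσc : ContinuousOn σ (Set.Ioi 0))
    (hσ : ∀ x > 0, 0 < σ x)
    (S' : ℝ → ℝ)
    (hS'def : ∀ x > 0, S' x = Real.exp (-(∫ z in c..x, 2 * μ z / σ z ^ 2)))
    (φ φ' φ'' : ℝ → ℝ → ℝ)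
    (hφd : ∀ lam > 0, ∀ x > 0, HasDerivAt (φ lam) (φ' lam x) x)
    (hφd2 : ∀ lam > 0, ∀ x > 0, HasDerivAt (φ' lam) (φ'' lam x) x)
    (hφ''c : ∀ lam > 0, ContinuousOn (φ'' lam) (Set.Ioi 0))
    (hφpos : ∀ lam > 0, ∀ x > 0, 0 < φ lam x)
    (hφanti : ∀ lam > 0, StrictAntiOn (φ lam) (Set.Ioi 0))
    (hode : ∀ lam > 0, ∀ x > 0,
      μ x * φ' lam x + σ x ^ 2 / 2 * φ'' lam x = lam * φ lam x)
    (hφ0 : ∀ lam > 0, Tendsto (φ lam) (nhdsWithin 0 (Set.Ioi 0)) atTop)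
    (hφStop : ∀ lam > 0, Tendsto (fun x => φ' lam x / S' x) atTop (nhds 0)) :
    ∀ x z lam lamh : ℝ, 0 < x → x < z → 0 < lam → lam ≤ lamh →
      φ lamh z / φ lamh x ≤ φ lam z / φ lam x := by
  intro x z lam lamh hx hxz hlam hle
  have hlamh : 0 < lamh := hlam.trans_le hle
  have hz : 0 < z := hx.trans hxz
  have hcont : ContinuousOn (fun y => 2 * μ y / σ y ^ 2) (Set.Ioi 0) :=
    (continuousOn_const.mul hμc).div (hσc.pow 2) fun y hy => pow_ne_zero 2 (hσ y hy).ne'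
  have hS' : ∀ y > 0, HasDerivAt S' (-(2 * μ y / σ y ^ 2) * S' y) y := by
    intro y hy
    rw [hS'def y hy]
    exact (hasDerivAt_exp_neg_integral hc hy hcont).congr_of_eventuallyEq
      (by filter_upwards [Ioi_mem_nhds hy] with w hw using hS'def w hw)
  have hS'pos : ∀ y > 0, 0 < S' y := fun y hy => by
    rw [hS'def y hy]
    exact Real.exp_pos _
  have hanti := antitoneOn_div_of_wronskian_nonpos (hφd lam hlam) (hφd lamh hlamh)
    (hφpos lam hlam) fun y hy => wronskian_nonpos hle hσ hS'pos hS' (hφd lam hlam)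
      (hφd2 lam hlam) (hφd lamh hlamh) (hφd2 lamh hlamh) (hφpos lam hlam) (hφpos lamh hlamh)
      (hφanti lam hlam).antitoneOn (hφanti lamh hlamh).antitoneOn (hode lam hlam)
      (hode lamh hlamh) (hφStop lam hlam) (hφStop lamh hlamh) hy
  have h := hanti hx hz hxz.le
  have hfx := hφpos lam hlam x hx
  have hfz := hφpos lam hlam z hz
  have hgx := hφpos lamh hlamh x hx
  simp only at h
  rw [div_le_div_iff₀ hfz hfx] at h
  rw [div_le_div_iff₀ hgx hfx]
  linarith
end

section
/- Let y*_s ∈ (x*, ∞) be the unique root of x ↦ H(0,x), and for each λ > 0 define Ĝ_λ(x) = L_λ(x) + (φ_λ'(x)/(S'(x) m(0,x))) H(0,x). Then for every λ > 0, Ĝ_λ(y*_s) = L_λ(y*_s) = λ ∫_{y*_s}^∞ (π_μ(z) − π_μ(y*_s)) φ_λ(z) m'(z) dz, and ∫_{y*_s}^∞ (φ_λ(z)/φ_λ(y*_s)) (π_μ(z) − π_μ(y*_s)) m'(z) dz → 0 as λ → ∞. -/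
open MeasureTheory Filter

/-- The scale density solves `S'' = -(2μ/σ²) S'`. -/
theorem hasDerivAt_scaleDensity {μ σ S' : ℝ → ℝ} {c : ℝ} (hc : 0 < c)
    (hμc : ContinuousOn μ (Set.Ioi 0)) (hσc : ContinuousOn σ (Set.Ioi 0))
    (hσ : ∀ x > 0, 0 < σ x)
    (hS'def : ∀ x > 0, S' x = Real.exp (-(∫ z in c..x, 2 * μ z / σ z ^ 2)))
    {x : ℝ} (hx : 0 < x) :
    HasDerivAt S' (-(2 * μ x / σ x ^ 2) * S' x) x := by
  have hcont : ContinuousOn (fun z => 2 * μ z / σ z ^ 2) (Set.Ioi 0) :=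
    (continuousOn_const.mul hμc).div (hσc.pow 2) fun z hz => (pow_pos (hσ z hz) 2).ne'
  have hint : IntervalIntegrable (fun z => 2 * μ z / σ z ^ 2) volume c x := by
    refine (hcont.mono fun z hz => ?_).intervalIntegrable
    exact (lt_min hc hx).trans_le hz.1
  have hd := (intervalIntegral.integral_hasDerivAt_right hint
    (hcont.stronglyMeasurableAtFilter isOpen_Ioi x hx)
    (hcont.continuousAt (Ioi_mem_nhds hx))).neg.exp
  refine (hd.congr_of_eventuallyEq ?_).congr_deriv ?_
  · filter_upwards [Ioi_mem_nhds hx] with z hz using hS'def z hz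
  · rw [hS'def x hx]
    exact mul_comm _ _

/-- In terms of scale and speed, the equation `μ f' + σ²/2 f'' = r f` reads
`(f' / S')' = r f m'`. -/
theorem hasDerivAt_div_scaleDensity {S' f' : ℝ → ℝ} {μ σ m f f'' r x : ℝ}
    (hσ : 0 < σ) (hSpos : 0 < S' x)
    (hS : HasDerivAt S' (-(2 * μ / σ ^ 2) * S' x) x)
    (hm : m = 2 / (σ ^ 2 * S' x)) (hf' : HasDerivAt f' f'' x)
    (hode : μ * f' x + σ ^ 2 / 2 * f'' = r * f) :
    HasDerivAt (fun z => f' z / S' z) (r * f * m) x := by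
  refine (hf'.div hS hSpos.ne').congr_deriv ?_
  rw [← hode, hm]
  field_simp
  ring

/-- If `r ≤ s`, `f` and `g` decrease, and solve `(f'/S')' = r f m'` and `(g'/S')' = s g m'` with
derivatives in scale vanishing at infinity, then `g / f` is antitone. -/
theorem antitoneOn_div_of_scale_speed {S' m' f f' g g' : ℝ → ℝ} {r s : ℝ} (hrs : r ≤ s)
    (hS : ∀ x > 0, 0 < S' x) (hm : ∀ x > 0, 0 < m' x)
    (hf : ∀ x > 0, HasDerivAt f (f' x) x) (hg : ∀ x > 0, HasDerivAt g (g' x) x)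
    (hfpos : ∀ x > 0, 0 < f x) (hgpos : ∀ x > 0, 0 < g x)
    (hfanti : AntitoneOn f (Set.Ioi 0)) (hganti : AntitoneOn g (Set.Ioi 0))
    (hf' : ∀ x > 0, HasDerivAt (fun z => f' z / S' z) (r * f x * m' x) x)
    (hg' : ∀ x > 0, HasDerivAt (fun z => g' z / S' z) (s * g x * m' x) x)
    (hf0 : Tendsto (fun x => f' x / S' x) atTop (nhds 0))
    (hg0 : Tendsto (fun x => g' x / S' x) atTop (nhds 0)) :
    AntitoneOn (fun x => g x / f x) (Set.Ioi 0) := by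
  set W : ℝ → ℝ := fun x => g' x / S' x * f x - f' x / S' x * g x with hW
  have hWd : ∀ x > 0, HasDerivAt W ((s - r) * f x * g x * m' x) x := fun x hx => by
    refine (((hg' x hx).mul (hf x hx)).sub ((hf' x hx).mul (hg x hx))).congr_deriv ?_
    have := (hS x hx).ne'
    field_simp
    ring
  have hWmono : MonotoneOn W (Set.Ioi 0) := by
    refine monotoneOn_of_deriv_nonneg (convex_Ioi 0)
      (fun x hx => (hWd x hx).continuousAt.continuousWithinAt)
      (fun x hx => ?_) (fun x hx => ?_)
    · rw [interior_Ioi] at hx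
      exact (hWd x hx).differentiableAt.differentiableWithinAt
    · rw [interior_Ioi] at hx
      rw [(hWd x hx).deriv]
      have := hfpos x hx
      have := hgpos x hx
      have := hm x hx
      have := sub_nonneg.2 hrs
      positivity
  have hbdd : ∀ h : ℝ → ℝ, (∀ x > 0, 0 < h x) → AntitoneOn h (Set.Ioi 0) →
      IsBoundedUnder (· ≤ ·) atTop (norm ∘ h) := fun h hpos hanti => by
    refine isBoundedUnder_of_eventually_le (a := h 1) ?_
    filter_upwards [eventually_ge_atTop 1] with x hx
    have hx0 : (0 : ℝ) < x := one_pos.trans_le hx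
    simpa [abs_of_pos (hpos x hx0)] using hanti (Set.mem_Ioi.2 one_pos) hx0 hx
  have hWlim : Tendsto W atTop (nhds 0) := by
    simpa using (hg0.zero_mul_isBoundedUnder_le (hbdd f hfpos hfanti)).sub
      (hf0.zero_mul_isBoundedUnder_le (hbdd g hgpos hganti))
  have hWle : ∀ x > 0, W x ≤ 0 := fun x hx => by
    refine ge_of_tendsto hWlim ?_
    filter_upwards [eventually_ge_atTop x] with z hz
    exact hWmono hx (hx.trans_le hz) hz
  have hd : ∀ x > 0, HasDerivAt (fun z => g z / f z) ((g' x * f x - g x * f' x) / f x ^ 2) x :=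
    fun x hx => (hg x hx).div (hf x hx) (hfpos x hx).ne'
  refine antitoneOn_of_deriv_nonpos (convex_Ioi 0)
    (fun x hx => (hd x hx).continuousAt.continuousWithinAt)
    (fun x hx => ?_) (fun x hx => ?_)
  · rw [interior_Ioi] at hx
    exact (hd x hx).differentiableAt.differentiableWithinAt
  · rw [interior_Ioi] at hx
    rw [(hd x hx).deriv]
    refine div_nonpos_of_nonpos_of_nonneg ?_ (sq_nonneg _)
    have hSx := hS x hx
    have : g' x * f x - g x * f' x = S' x * W x := by
      simp only [hW]
      field_simp
    rw [this]
    exact mul_nonpos_of_nonneg_of_nonpos hSx.le (hWle x hx)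

/-- A positive decreasing solution of `(f'/S')' = r f m'` satisfies `r f(z) K ≤ f(y)` for `y < z`,
with `K` determined by lower bounds of `S'` and `m'` on `[y, z]`. -/
theorem mul_le_of_scale_speed {S' m' f f' : ℝ → ℝ} {r y w z a b : ℝ} (hr : 0 ≤ r)
    (hyw : y < w) (hwz : w < z) (ha : 0 ≤ a) (hb : 0 ≤ b)
    (hS : ∀ x ∈ Set.Icc y z, 0 < S' x) (hSb : ∀ x ∈ Set.Icc y z, b ≤ S' x)
    (hma : ∀ x ∈ Set.Icc y z, a ≤ m' x)
    (hf : ∀ x ∈ Set.Icc y z, HasDerivAt f (f' x) x)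
    (hfpos : ∀ x ∈ Set.Icc y z, 0 < f x)
    (hfanti : AntitoneOn f (Set.Icc y z))
    (hf'nonpos : ∀ x ∈ Set.Icc y z, f' x ≤ 0)
    (hf' : ∀ x ∈ Set.Icc y z, HasDerivAt (fun t => f' t / S' t) (r * f x * m' x) x) :
    r * f z * (a * b * (z - w) * (w - y)) ≤ f y := by
  have hzmem : z ∈ Set.Icc y z := ⟨(hyw.trans hwz).le, le_rfl⟩
  have hwmem : w ∈ Set.Icc y z := ⟨hyw.le, hwz.le⟩
  have hfz := hfpos z hzmem
  have hstep : ∀ u ∈ Set.Icc y z, ∀ v ∈ Set.Icc y z, u < v →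
      r * f z * a * (v - u) ≤ f' v / S' v - f' u / S' u := fun u hu v hv huv => by
    obtain ⟨ξ, hξ, he⟩ := exists_hasDerivAt_eq_slope (fun t => f' t / S' t)
      (fun x => r * f x * m' x) huv
      (fun x hx => (hf' x ⟨hu.1.trans hx.1, hx.2.trans hv.2⟩).continuousAt.continuousWithinAt)
      (fun x hx => hf' x ⟨hu.1.trans hx.1.le, hx.2.le.trans hv.2⟩)
    have hξm : ξ ∈ Set.Icc y z := ⟨hu.1.trans hξ.1.le, hξ.2.le.trans hv.2⟩
    have hvu : 0 < v - u := sub_pos.2 huv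
    rw [eq_div_iff hvu.ne'] at he
    rw [← he]
    have h1 : f z ≤ f ξ := hfanti hξm hzmem hξm.2
    have h2 := hma ξ hξm
    have h3 := hfpos ξ hξm
    gcongr
  have hgw : r * f z * a * (z - w) ≤ -(f' w / S' w) := by
    have h1 := hstep w hwmem z hzmem hwz
    have h2 := div_nonpos_of_nonpos_of_nonneg (hf'nonpos z hzmem) (hS z hzmem).le
    linarith
  obtain ⟨ξ, hξ, he⟩ := exists_hasDerivAt_eq_slope f f' hyw
    (fun x hx => (hf x ⟨hx.1, hx.2.trans hwz.le⟩).continuousAt.continuousWithinAt)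
    (fun x hx => hf x ⟨hx.1.le, hx.2.le.trans hwz.le⟩)
  have hξm : ξ ∈ Set.Icc y z := ⟨hξ.1.le, hξ.2.le.trans hwz.le⟩
  have hwy : 0 < w - y := sub_pos.2 hyw
  have hzw : 0 < z - w := sub_pos.2 hwz
  rw [eq_div_iff hwy.ne'] at he
  have hSξ := hS ξ hξm
  have hgξ : r * f z * a * (z - w) ≤ -(f' ξ / S' ξ) := by
    have h1 := hstep ξ hξm w hwmem hξ.2
    have h2 : 0 ≤ r * f z * a * (w - ξ) := by
      have := sub_nonneg.2 hξ.2.le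
      positivity
    linarith
  have hA : 0 ≤ r * f z * a * (z - w) := by positivity
  have hslope : r * f z * a * (z - w) * b ≤ -f' ξ := by
    calc r * f z * a * (z - w) * b ≤ -(f' ξ / S' ξ) * S' ξ :=
          mul_le_mul hgξ (hSb ξ hξm) hb (hA.trans hgξ)
      _ = -f' ξ := by field_simp
  have hfw := hfpos w hwmem
  have := mul_le_mul_of_nonneg_right hslope hwy.le
  linarith

/-- Let y*_s ∈ (x*,∞) be the unique root of x ↦ H(0,x), and
    Ĝ_λ(x) = L_λ(x) + (φ_λ'(x)/(S'(x) m(0,x))) H(0,x). Then for every λ > 0,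
    Ĝ_λ(y*_s) = L_λ(y*_s) = λ ∫_{y*_s}^∞ (π_μ(z) − π_μ(y*_s)) φ_λ(z) m'(z) dz, and
    ∫_{y*_s}^∞ (φ_λ(z)/φ_λ(y*_s)) (π_μ(z) − π_μ(y*_s)) m'(z) dz → 0 as λ → ∞. -/
theorem stmt_15
    (μ σ pf : ℝ → ℝ) (c : ℝ) (hc : 0 < c)
    (hμc : ContinuousOn μ (Set.Ioi 0)) (hσc : ContinuousOn σ (Set.Ioi 0))
    (hσ : ∀ x > 0, 0 < σ x)
    (S' m' : ℝ → ℝ)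
    (hS'def : ∀ x > 0, S' x = Real.exp (-(∫ z in c..x, 2 * μ z / σ z ^ 2)))
    (hm'def : ∀ x > 0, m' x = 2 / (σ x ^ 2 * S' x))
    (m0 : ℝ → ℝ) (hm0def : ∀ x > 0, m0 x = ∫ z in Set.Ioc 0 x, m' z)
    (φ φ' φ'' : ℝ → ℝ → ℝ)
    (hφd : ∀ lam > 0, ∀ x > 0, HasDerivAt (φ lam) (φ' lam x) x)
    (hφd2 : ∀ lam > 0, ∀ x > 0, HasDerivAt (φ' lam) (φ'' lam x) x)
    (hφ''c : ∀ lam > 0, ContinuousOn (φ'' lam) (Set.Ioi 0))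
    (hφpos : ∀ lam > 0, ∀ x > 0, 0 < φ lam x)
    (hφanti : ∀ lam > 0, StrictAntiOn (φ lam) (Set.Ioi 0))
    (hode : ∀ lam > 0, ∀ x > 0,
      μ x * φ' lam x + σ x ^ 2 / 2 * φ'' lam x = lam * φ lam x)
    (hφ0 : ∀ lam > 0, Tendsto (φ lam) (nhdsWithin 0 (Set.Ioi 0)) atTop)
    (hφStop : ∀ lam > 0, Tendsto (fun x => φ' lam x / S' x) atTop (nhds 0))
    (hpfc : ContinuousOn pf (Set.Ioi 0)) (hpfnn : ∀ x > 0, 0 ≤ pf x)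
    (γ : ℝ) (hγ : 0 < γ)
    (pmu : ℝ → ℝ) (hpmudef : ∀ x > 0, pmu x = pf x + γ * μ x)
    (L : ℝ → ℝ → ℝ)
    (hLdef : ∀ lam > 0, ∀ x > 0,
      L lam x = lam * (∫ z in Set.Ioi x, pmu z * φ lam z * m' z)
        + φ' lam x / S' x * pmu x)
    (H : ℝ → ℝ)
    (hHdef : ∀ x > 0, H x = (∫ z in Set.Ioc 0 x, pmu z * m' z) - pmu x * m0 x)
    (xstar : ℝ) (hxstar : 0 < xstar)
    (hdec : StrictAntiOn pmu (Set.Ioo 0 xstar))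
    (hinc : StrictMonoOn pmu (Set.Ici xstar))
    (hlimpos : ∃ ε > 0, ∀ᶠ x in atTop, ε ≤ pmu x)
    (hmi : ∀ y > 0, IntegrableOn m' (Set.Ioc 0 y))
    (hpmi : ∀ y > 0, IntegrableOn (fun z => pmu z * m' z) (Set.Ioc 0 y))
    (hφi : ∀ lam > 0, ∀ x > 0, IntegrableOn (fun z => φ lam z * m' z) (Set.Ioi x))
    (hpφi : ∀ lam > 0, ∀ x > 0,
      IntegrableOn (fun z => pmu z * φ lam z * m' z) (Set.Ioi x))
    (ys : ℝ) (hys : ys ∈ Set.Ioi xstar) (hHys : H ys = 0)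
    (hysu : ∀ x > 0, H x = 0 → x = ys) :
    (∀ lam > 0,
      L lam ys + φ' lam ys / (S' ys * m0 ys) * H ys = L lam ys ∧
      L lam ys = lam * ∫ z in Set.Ioi ys, (pmu z - pmu ys) * φ lam z * m' z) ∧
    Tendsto
      (fun lam => ∫ z in Set.Ioi ys, φ lam z / φ lam ys * (pmu z - pmu ys) * m' z)
      atTop (nhds 0) := by
  have hys0 : 0 < ys := hxstar.trans hys
  have hSpos : ∀ x > 0, 0 < S' x := fun x hx => by
    rw [hS'def x hx]
    exact Real.exp_pos _
  have hSd : ∀ x > 0, HasDerivAt S' (-(2 * μ x / σ x ^ 2) * S' x) x := fun x hx =>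
    hasDerivAt_scaleDensity hc hμc hσc hσ hS'def hx
  have hmpos : ∀ x > 0, 0 < m' x := fun x hx => by
    rw [hm'def x hx]
    have := hσ x hx
    have := hSpos x hx
    positivity
  have hScont : ContinuousOn S' (Set.Ioi 0) := fun x hx =>
    (hSd x hx).continuousAt.continuousWithinAt
  have hmcont : ContinuousOn m' (Set.Ioi 0) := by
    refine ContinuousOn.congr (f := fun x => 2 / (σ x ^ 2 * S' x)) ?_ fun x hx => hm'def x hx
    exact continuousOn_const.div ((hσc.pow 2).mul hScont) fun x hx =>
      (mul_pos (pow_pos (hσ x hx) 2) (hSpos x hx)).ne'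
  have hQd : ∀ lam > 0, ∀ x > 0,
      HasDerivAt (fun z => φ' lam z / S' z) (lam * φ lam x * m' x) x := fun lam hl x hx =>
    hasDerivAt_div_scaleDensity (hσ x hx) (hSpos x hx) (hSd x hx) (hm'def x hx)
      (hφd2 lam hl x hx) (hode lam hl x hx)
  have hdiff : ∀ lam > 0,
      IntegrableOn (fun z => (pmu z - pmu ys) * φ lam z * m' z) (Set.Ioi ys) := fun lam hl => by
    refine ((hpφi lam hl ys hys0).sub ((hφi lam hl ys hys0).const_mul (pmu ys))).congr
      (Eventually.of_forall fun z => ?_)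
    simp only [Pi.sub_apply]
    ring
  have hquot : ∀ lam > 0,
      IntegrableOn (fun z => φ lam z / φ lam ys * (pmu z - pmu ys) * m' z) (Set.Ioi ys) :=
    fun lam hl => by
      refine ((hdiff lam hl).const_mul (φ lam ys)⁻¹).congr (Eventually.of_forall fun z => ?_)
      ring
  refine ⟨fun lam hl => ⟨by rw [hHys, mul_zero, add_zero], ?_⟩, ?_⟩
  · have hflux : ∫ z in Set.Ioi ys, lam * (φ lam z * m' z) = 0 - φ' lam ys / S' ys :=
      integral_Ioi_of_hasDerivAt_of_tendsto
        (hQd lam hl ys hys0).continuousAt.continuousWithinAt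
        (fun x hx => (hQd lam hl x (hys0.trans hx)).congr_deriv (mul_assoc _ _ _))
        ((hφi lam hl ys hys0).const_mul lam) (hφStop lam hl)
    rw [integral_const_mul] at hflux
    have hsplit : ∫ z in Set.Ioi ys, (pmu z - pmu ys) * φ lam z * m' z
        = (∫ z in Set.Ioi ys, pmu z * φ lam z * m' z)
          - pmu ys * ∫ z in Set.Ioi ys, φ lam z * m' z := by
      rw [← integral_const_mul,
        ← integral_sub (hpφi lam hl ys hys0) ((hφi lam hl ys hys0).const_mul (pmu ys))]
      congr 1
      funext z
      ring
    rw [hLdef lam hl ys hys0, hsplit]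
    linear_combination pmu ys * hflux
  · have hratio : ∀ z ∈ Set.Ioi ys,
        Tendsto (fun lam => φ lam z / φ lam ys) atTop (nhds 0) := fun z hz => by
      have hsub : Set.Icc ys z ⊆ Set.Ioi 0 := fun x hx => hys0.trans_le hx.1
      have hne : (Set.Icc ys z).Nonempty := Set.nonempty_Icc.2 (le_of_lt hz)
      obtain ⟨u, hu, humin⟩ := isCompact_Icc.exists_isMinOn hne (hScont.mono hsub)
      obtain ⟨v, hv, hvmin⟩ := isCompact_Icc.exists_isMinOn hne (hmcont.mono hsub)
      obtain ⟨w, hyw, hwz⟩ := exists_between (Set.mem_Ioi.1 hz)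
      set K := m' v * S' u * (z - w) * (w - ys) with hK
      have hKpos : 0 < K :=
        mul_pos (mul_pos (mul_pos (hmpos v (hsub hv)) (hSpos u (hsub hu))) (sub_pos.2 hwz))
          (sub_pos.2 hyw)
      have hlim : Tendsto (fun lam : ℝ => K⁻¹ * lam⁻¹) atTop (nhds 0) := by
        simpa using tendsto_inv_atTop_zero.const_mul K⁻¹
      refine tendsto_of_tendsto_of_tendsto_of_le_of_le' tendsto_const_nhds hlim ?_ ?_
      · filter_upwards [eventually_gt_atTop 0] with lam hl
        exact (div_pos (hφpos lam hl z (hys0.trans hz)) (hφpos lam hl ys hys0)).le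
      · filter_upwards [eventually_gt_atTop 0] with lam hl
        have hanti := (hφanti lam hl).antitoneOn
        have hmain := mul_le_of_scale_speed (f := φ lam) (f' := φ' lam) hl.le hyw hwz
          (hmpos v (hsub hv)).le (hSpos u (hsub hu)).le (fun x hx => hSpos x (hsub hx))
          (fun x hx => humin hx) (fun x hx => hvmin hx) (fun x hx => hφd lam hl x (hsub hx))
          (fun x hx => hφpos lam hl x (hsub hx)) (hanti.mono hsub)
          (fun x hx => by
            rw [← (hφd lam hl x (hsub hx)).deriv,
              ← derivWithin_of_isOpen isOpen_Ioi (hsub hx)]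
            exact hanti.derivWithin_nonpos)
          (fun x hx => hQd lam hl x (hsub hx))
        rw [← hK] at hmain
        rw [div_le_iff₀ (hφpos lam hl ys hys0), ← mul_inv, ← div_eq_inv_mul,
          le_div_iff₀ (mul_pos hKpos hl)]
        linarith
    have hdom := tendsto_integral_filter_of_dominated_convergence
      (μ := volume.restrict (Set.Ioi ys)) (l := atTop)
      (F := fun lam z => φ lam z / φ lam ys * (pmu z - pmu ys) * m' z) (f := fun _ => 0)
      (fun z => ‖φ 1 z / φ 1 ys * (pmu z - pmu ys) * m' z‖) ?_ ?_ ?_ ?_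
    · simpa using hdom
    · filter_upwards [eventually_gt_atTop 0] with lam hl
      exact (hquot lam hl).aestronglyMeasurable
    · filter_upwards [eventually_ge_atTop 1] with lam hl
      have hl0 : 0 < lam := one_pos.trans_le hl
      filter_upwards [ae_restrict_mem measurableSet_Ioi] with z hz
      have hz0 : 0 < z := hys0.trans hz
      have hle : φ lam z / φ lam ys ≤ φ 1 z / φ 1 ys := by
        have h := antitoneOn_div_of_scale_speed hl hSpos hmpos (hφd 1 one_pos) (hφd lam hl0)
          (hφpos 1 one_pos) (hφpos lam hl0) (hφanti 1 one_pos).antitoneOn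
          (hφanti lam hl0).antitoneOn (hQd 1 one_pos) (hQd lam hl0)
          (hφStop 1 one_pos) (hφStop lam hl0) hys0 hz0 (le_of_lt hz)
        simp only at h
        rw [div_le_div_iff₀ (hφpos 1 one_pos z hz0) (hφpos 1 one_pos ys hys0)] at h
        rw [div_le_div_iff₀ (hφpos lam hl0 ys hys0) (hφpos 1 one_pos ys hys0)]
        linarith
      have hnn : 0 ≤ φ lam z / φ lam ys :=
        (div_pos (hφpos lam hl0 z hz0) (hφpos lam hl0 ys hys0)).le
      simp only [norm_mul, Real.norm_of_nonneg hnn, Real.norm_of_nonneg (hnn.trans hle)]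
      gcongr
    · exact (hquot 1 one_pos).norm
    · filter_upwards [ae_restrict_mem measurableSet_Ioi] with z hz
      simpa using ((hratio z hz).mul_const (pmu z - pmu ys)).mul_const (m' z)
end

section
/- The function K(x) = (∫_x^∞ π_μ(z) φ_λ(z) m'(z) dz) / (∫_x^∞ φ_λ(z) m'(z) dz) is differentiable on (0,∞) with K'(x) = φ_λ(x) m'(x) L(x) / (λ (∫_x^∞ φ_λ(z) m'(z) dz)²) for all x > 0. -/
open MeasureTheory Filter

/-- The tail integral of a function continuous near `x` has derivative `-f x` at `x`. -/
theorem hasDerivAt_integral_Ioi_left {f : ℝ → ℝ} {a x : ℝ} (hax : a < x)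
    (hc : ContinuousOn f (Set.Ioi a)) (hi : IntegrableOn f (Set.Ioi a)) :
    HasDerivAt (fun t => ∫ z in Set.Ioi t, f z) (-f x) x := by
  have hx : Set.Ioi a ∈ nhds x := Ioi_mem_nhds hax
  have hii : ∀ t > a, IntervalIntegrable f volume a t := fun t ht =>
    (intervalIntegrable_iff_integrableOn_Ioc_of_le ht.le).2
      (hi.mono_set Set.Ioc_subset_Ioi_self)
  have hd : HasDerivAt (fun t => ∫ z in a..t, f z) (f x) x :=
    intervalIntegral.integral_hasDerivAt_right (hii x hax)
      (hc.stronglyMeasurableAtFilter isOpen_Ioi x hax) (hc.continuousAt hx)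
  refine (hd.const_sub (∫ z in Set.Ioi a, f z)).congr_of_eventuallyEq ?_
  filter_upwards [hx] with t ht
  have := intervalIntegral.integral_interval_add_Ioi hi
    (hi.mono_set (Set.Ioi_subset_Ioi (le_of_lt ht)))
  linarith

/-- If `s = exp (-∫ g)`, then `f / s` has derivative `(f' + g f) / s`. -/
theorem hasDerivAt_div_exp_neg_integral {g f s : ℝ → ℝ} {c x f' : ℝ} (hc : 0 < c) (hx : 0 < x)
    (hg : ContinuousOn g (Set.Ioi 0)) (hs : ∀ x > 0, s x = Real.exp (-∫ z in c..x, g z))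
    (hf : HasDerivAt f f' x) :
    HasDerivAt (fun t => f t / s t) ((f' + g x * f x) / s x) x := by
  have hn : Set.Ioi (0 : ℝ) ∈ nhds x := Ioi_mem_nhds hx
  have hii : IntervalIntegrable g volume c x :=
    (hg.mono fun y hy => lt_of_lt_of_le (lt_min hc hx) hy.1).intervalIntegrable
  have hd : HasDerivAt (fun t => ∫ z in c..t, g z) (g x) x :=
    intervalIntegral.integral_hasDerivAt_right hii
      (hg.stronglyMeasurableAtFilter isOpen_Ioi x hx) (hg.continuousAt hn)
  have hsd : HasDerivAt s (s x * -g x) x := by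
    rw [hs x hx]
    refine hd.neg.exp.congr_of_eventuallyEq ?_
    filter_upwards [hn] with t ht using hs t ht
  have hs0 : s x ≠ 0 := by rw [hs x hx]; exact (Real.exp_pos _).ne'
  refine (hf.div hsd hs0).congr_deriv ?_
  field_simp
  ring

/-- K(x) = (∫_x^∞ π_μ φ_λ m') / (∫_x^∞ φ_λ m') is differentiable on
    (0,∞) with K'(x) = φ_λ(x) m'(x) L(x) / (λ (∫_x^∞ φ_λ m')²). -/
theorem stmt_17
    (μ σ pf : ℝ → ℝ) (c : ℝ) (hc : 0 < c)
    (hμc : ContinuousOn μ (Set.Ioi 0)) (hσc : ContinuousOn σ (Set.Ioi 0))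
    (hσ : ∀ x > 0, 0 < σ x)
    (S' m' : ℝ → ℝ)
    (hS'def : ∀ x > 0, S' x = Real.exp (-(∫ z in c..x, 2 * μ z / σ z ^ 2)))
    (hm'def : ∀ x > 0, m' x = 2 / (σ x ^ 2 * S' x))
    (lam : ℝ) (hlam : 0 < lam)
    (φ φ' φ'' : ℝ → ℝ)
    (hφd : ∀ x > 0, HasDerivAt φ (φ' x) x)
    (hφd2 : ∀ x > 0, HasDerivAt φ' (φ'' x) x)
    (hφ''c : ContinuousOn φ'' (Set.Ioi 0))
    (hφpos : ∀ x > 0, 0 < φ x)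
    (hφanti : StrictAntiOn φ (Set.Ioi 0))
    (hode : ∀ x > 0, μ x * φ' x + σ x ^ 2 / 2 * φ'' x = lam * φ x)
    (hpfc : ContinuousOn pf (Set.Ioi 0)) (hpfnn : ∀ x > 0, 0 ≤ pf x)
    (γ : ℝ) (hγ : 0 < γ)
    (pmu : ℝ → ℝ) (hpmudef : ∀ x > 0, pmu x = pf x + γ * μ x)
    (L : ℝ → ℝ)
    (hLdef : ∀ x > 0,
      L x = lam * (∫ z in Set.Ioi x, pmu z * φ z * m' z) + φ' x / S' x * pmu x)
    (hφi : ∀ x > 0, IntegrableOn (fun z => φ z * m' z) (Set.Ioi x))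
    (hpφi : ∀ x > 0, IntegrableOn (fun z => pmu z * φ z * m' z) (Set.Ioi x))
    (hφStop : Tendsto (fun x => φ' x / S' x) atTop (nhds 0)) :
    ∀ x > 0, HasDerivAt
      (fun t => (∫ z in Set.Ioi t, pmu z * φ z * m' z) / ∫ z in Set.Ioi t, φ z * m' z)
      (φ x * m' x * L x / (lam * (∫ z in Set.Ioi x, φ z * m' z) ^ 2)) x := by
  have hS'pos : ∀ x > 0, 0 < S' x := fun x hx => by rw [hS'def x hx]; exact Real.exp_pos _
  have hgc : ContinuousOn (fun z => 2 * μ z / σ z ^ 2) (Set.Ioi 0) :=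
    (continuousOn_const.mul hμc).div (hσc.pow 2) fun x hx => (pow_pos (hσ x hx) 2).ne'
  have hm'pos : ∀ x > 0, 0 < m' x := fun x hx => by
    rw [hm'def x hx]
    have := hσ x hx
    have := hS'pos x hx
    positivity
  have hφS' : ∀ x > 0, HasDerivAt (fun t => φ' t / S' t) (lam * (φ x * m' x)) x := by
    intro x hx
    refine (hasDerivAt_div_exp_neg_integral hc hx hgc hS'def (hφd2 x hx)).congr_deriv ?_
    have hσ0 := (hσ x hx).ne'
    have hS'0 := (hS'pos x hx).ne'
    rw [hm'def x hx]
    field_simp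
    linear_combination 2 * hode x hx
  have htail : ∀ x > 0, φ' x / S' x = -(lam * ∫ z in Set.Ioi x, φ z * m' z) := by
    intro x hx
    have h := integral_Ioi_of_hasDerivAt_of_tendsto
      (hφS' x hx).continuousAt.continuousWithinAt
      (fun y hy => hφS' y (lt_trans hx hy)) ((hφi x hx).const_mul lam) hφStop
    rw [integral_const_mul] at h
    linarith
  have hS'c : ContinuousOn S' (Set.Ioi 0) := by
    intro x hx
    have h := (hasDerivAt_div_exp_neg_integral hc hx hgc hS'def
      (hasDerivAt_const x (1 : ℝ))).continuousAt.inv₀ (one_div_pos.2 (hS'pos x hx)).ne'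
    simpa [Pi.inv_def] using h.continuousWithinAt
  have hm'c : ContinuousOn m' (Set.Ioi 0) :=
    (continuousOn_const.div ((hσc.pow 2).mul hS'c) fun x hx =>
      (mul_pos (pow_pos (hσ x hx) 2) (hS'pos x hx)).ne').congr hm'def
  have hφc : ContinuousOn φ (Set.Ioi 0) := fun x hx => (hφd x hx).continuousAt.continuousWithinAt
  have hpmuc : ContinuousOn pmu (Set.Ioi 0) :=
    (hpfc.add (continuousOn_const.mul hμc)).congr hpmudef
  intro x hx
  have hx2 : 0 < x / 2 := half_pos hx
  have hsub : Set.Ioi (x / 2) ⊆ Set.Ioi (0 : ℝ) := Set.Ioi_subset_Ioi hx2.le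
  have hN := hasDerivAt_integral_Ioi_left (f := fun z => pmu z * φ z * m' z) (half_lt_self hx)
    (((hpmuc.mul hφc).mul hm'c).mono hsub) (hpφi _ hx2)
  have hD := hasDerivAt_integral_Ioi_left (f := fun z => φ z * m' z) (half_lt_self hx)
    ((hφc.mul hm'c).mono hsub) (hφi _ hx2)
  have hpos : 0 < ∫ z in Set.Ioi x, φ z * m' z := by
    have hp : ∀ z ∈ Set.Ioi x, 0 < φ z * m' z := fun z hz =>
      mul_pos (hφpos z (lt_trans hx hz)) (hm'pos z (lt_trans hx hz))
    rw [setIntegral_pos_iff_support_of_nonneg_ae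
      ((ae_restrict_mem measurableSet_Ioi).mono fun z hz => (hp z hz).le) (hφi x hx),
      Set.inter_eq_right.2 fun z hz => Function.mem_support.2 (hp z hz).ne']
    simp
  refine (hN.div hD hpos.ne').congr_deriv ?_
  rw [hLdef x hx, htail x hx]
  have := hpos.ne'
  have := hlam.ne'
  field_simp
  ring
end

section
/- For all 0 < x < y < x*, L(x) − L(y) ≤ (φ_λ'(y)/S'(y)) (π_μ(x) − π_μ(y)); consequently, if in addition lim_{x↓0} π_μ(x) = ∞, then lim_{x↓0} L(x) = −∞. -/
open MeasureTheory Filter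

/-- If `μ φ' + (σ² / 2) φ'' = lam φ`, then `φ' / S'` has derivative `lam φ m'`, where `S'` and
`m'` are the scale and speed densities. -/
theorem hasDerivAt_div_scaleDensity_s18
    {μ σ : ℝ → ℝ} {c : ℝ} (hc : 0 < c)
    (hμc : ContinuousOn μ (Set.Ioi 0)) (hσc : ContinuousOn σ (Set.Ioi 0))
    (hσ : ∀ x > 0, 0 < σ x)
    {S' m' : ℝ → ℝ}
    (hS' : ∀ x > 0, S' x = Real.exp (-(∫ z in c..x, 2 * μ z / σ z ^ 2)))
    (hm' : ∀ x > 0, m' x = 2 / (σ x ^ 2 * S' x))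
    {lam : ℝ} {φ φ' φ'' : ℝ → ℝ}
    (hφ' : ∀ x > 0, HasDerivAt φ' (φ'' x) x)
    (hode : ∀ x > 0, μ x * φ' x + σ x ^ 2 / 2 * φ'' x = lam * φ x)
    {x : ℝ} (hx : 0 < x) :
    HasDerivAt (fun z => φ' z / S' z) (lam * (φ x * m' x)) x := by
  have hcont : ContinuousOn (fun z => 2 * μ z / σ z ^ 2) (Set.Ioi 0) :=
    (continuousOn_const.mul hμc).div (hσc.pow 2) fun z hz => pow_ne_zero 2 (hσ z hz).ne'
  have hsub : Set.uIcc c x ⊆ Set.Ioi 0 := fun z hz => lt_of_lt_of_le (lt_min hc hx) hz.1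
  have hint : HasDerivAt (fun u => ∫ z in c..u, 2 * μ z / σ z ^ 2) (2 * μ x / σ x ^ 2) x :=
    intervalIntegral.integral_hasDerivAt_right (hcont.mono hsub).intervalIntegrable
      (hcont.stronglyMeasurableAtFilter isOpen_Ioi x hx)
      (hcont.continuousAt (Ioi_mem_nhds hx))
  have hS : HasDerivAt S' (S' x * -(2 * μ x / σ x ^ 2)) x := by
    rw [hS' x hx]
    exact hint.neg.exp.congr_of_eventuallyEq (by
      filter_upwards [Ioi_mem_nhds hx] with z hz using hS' z hz)
  have hSpos : 0 < S' x := by rw [hS' x hx]; exact Real.exp_pos _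
  have hσx := hσ x hx
  refine ((hφ' x hx).div hS hSpos.ne').congr_deriv ?_
  rw [hm' x hx]
  field_simp
  linear_combination 2 * hode x hx

/-- For all 0 < x < y < x*,
    L(x) − L(y) ≤ (φ_λ'(y)/S'(y))(π_μ(x) − π_μ(y)); consequently, if in addition
    lim_{x↓0} π_μ(x) = ∞, then lim_{x↓0} L(x) = −∞. -/
theorem stmt_18
    (μ σ pf : ℝ → ℝ) (c : ℝ) (hc : 0 < c)
    (hμc : ContinuousOn μ (Set.Ioi 0)) (hσc : ContinuousOn σ (Set.Ioi 0))
    (hσ : ∀ x > 0, 0 < σ x)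
    (S' m' : ℝ → ℝ)
    (hS'def : ∀ x > 0, S' x = Real.exp (-(∫ z in c..x, 2 * μ z / σ z ^ 2)))
    (hm'def : ∀ x > 0, m' x = 2 / (σ x ^ 2 * S' x))
    (lam : ℝ) (hlam : 0 < lam)
    (φ φ' φ'' : ℝ → ℝ)
    (hφd : ∀ x > 0, HasDerivAt φ (φ' x) x)
    (hφd2 : ∀ x > 0, HasDerivAt φ' (φ'' x) x)
    (hφ''c : ContinuousOn φ'' (Set.Ioi 0))
    (hφpos : ∀ x > 0, 0 < φ x)
    (hφanti : StrictAntiOn φ (Set.Ioi 0))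
    (hode : ∀ x > 0, μ x * φ' x + σ x ^ 2 / 2 * φ'' x = lam * φ x)
    (hpfc : ContinuousOn pf (Set.Ioi 0)) (hpfnn : ∀ x > 0, 0 ≤ pf x)
    (γ : ℝ) (hγ : 0 < γ)
    (pmu : ℝ → ℝ) (hpmudef : ∀ x > 0, pmu x = pf x + γ * μ x)
    (L : ℝ → ℝ)
    (hLdef : ∀ x > 0,
      L x = lam * (∫ z in Set.Ioi x, pmu z * φ z * m' z) + φ' x / S' x * pmu x)
    (xstar : ℝ) (hxstar : 0 < xstar)
    (hdec : StrictAntiOn pmu (Set.Ioo 0 xstar))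
    (hφi : ∀ x > 0, IntegrableOn (fun z => φ z * m' z) (Set.Ioi x))
    (hpφi : ∀ x > 0, IntegrableOn (fun z => pmu z * φ z * m' z) (Set.Ioi x)) :
    (∀ x y : ℝ, 0 < x → x < y → y < xstar →
      L x - L y ≤ φ' y / S' y * (pmu x - pmu y)) ∧
    (Tendsto pmu (nhdsWithin 0 (Set.Ioi 0)) atTop →
      Tendsto L (nhdsWithin 0 (Set.Ioi 0)) atBot) := by
  have hSpos : ∀ x > 0, 0 < S' x := fun x hx => by rw [hS'def x hx]; exact Real.exp_pos _
  have hmpos : ∀ x > 0, 0 < m' x := fun x hx => by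
    have := hσ x hx
    have := hSpos x hx
    rw [hm'def x hx]
    positivity
  have hg : ∀ x > 0, HasDerivAt (fun z => φ' z / S' z) (lam * (φ x * m' x)) x := fun x hx =>
    hasDerivAt_div_scaleDensity_s18 hc hμc hσc hσ hS'def hm'def hφd2 hode hx
  have hle : ∀ x y : ℝ, 0 < x → x < y → y < xstar →
      L x - L y ≤ φ' y / S' y * (pmu x - pmu y) := by
    intro x y hx hxy hy
    have hy0 : 0 < y := hx.trans hxy
    have hsub : Set.Ioc x y ⊆ Set.Ioi x := fun z hz => hz.1
    have hi : IntervalIntegrable (fun z => φ z * m' z) volume x y :=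
      (intervalIntegrable_iff_integrableOn_Ioc_of_le hxy.le).2 ((hφi x hx).mono_set hsub)
    have hpi : IntervalIntegrable (fun z => pmu z * φ z * m' z) volume x y :=
      (intervalIntegrable_iff_integrableOn_Ioc_of_le hxy.le).2 ((hpφi x hx).mono_set hsub)
    have hftc : lam * ∫ z in x..y, φ z * m' z = φ' y / S' y - φ' x / S' x := by
      rw [← intervalIntegral.integral_const_mul]
      refine intervalIntegral.integral_eq_sub_of_hasDerivAt (f := fun z => φ' z / S' z)
        (fun z hz => hg z ?_) (hi.const_mul lam)
      rw [Set.uIcc_of_le hxy.le] at hz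
      exact hx.trans_le hz.1
    have hmono : ∫ z in x..y, pmu z * φ z * m' z ≤ pmu x * ∫ z in x..y, φ z * m' z := by
      rw [← intervalIntegral.integral_const_mul]
      refine intervalIntegral.integral_mono_on hxy.le hpi (hi.const_mul _) fun z hz => ?_
      have hz0 : 0 < z := hx.trans_le hz.1
      have hp : pmu z ≤ pmu x :=
        hdec.antitoneOn ⟨hx, hxy.trans hy⟩ ⟨hz0, hz.2.trans_lt hy⟩ hz.1
      rw [mul_assoc]
      exact mul_le_mul_of_nonneg_right hp (mul_pos (hφpos z hz0) (hmpos z hz0)).le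
    have hsplit := intervalIntegral.integral_Ioi_sub_Ioi (hpφi x hx) hxy.le
    rw [hLdef x hx, hLdef y hy0]
    have hmul := mul_le_mul_of_nonneg_left hmono hlam.le
    rw [← hsplit] at hmul
    linear_combination hmul + pmu x * hftc
  refine ⟨hle, fun hlim => ?_⟩
  have hgmono : StrictMonoOn (fun z => φ' z / S' z) (Set.Ioi 0) := by
    refine strictMonoOn_of_deriv_pos (convex_Ioi 0)
      (fun x hx => (hg x hx).continuousAt.continuousWithinAt) fun x hx => ?_
    rw [interior_Ioi] at hx
    rw [(hg x hx).deriv]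
    exact mul_pos hlam (mul_pos (hφpos x hx) (hmpos x hx))
  have hφ'nonpos : ∀ x > 0, φ' x ≤ 0 := fun x hx => by
    rw [← (hφd x hx).deriv, ← derivWithin_of_isOpen isOpen_Ioi (Set.mem_Ioi.2 hx)]
    exact hφanti.antitoneOn.derivWithin_nonpos
  obtain ⟨y, hy0, hy⟩ := exists_between hxstar
  have hgneg : φ' y / S' y < 0 := by
    have hy1 : 0 < y + 1 := by linarith
    exact (hgmono hy0 hy1 (lt_add_one y)).trans_le
      (div_nonpos_of_nonpos_of_nonneg (hφ'nonpos _ hy1) (hSpos _ hy1).le)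
  have hbound : Tendsto (fun x => L y + φ' y / S' y * (pmu x - pmu y))
      (nhdsWithin 0 (Set.Ioi 0)) atBot :=
    tendsto_atBot_add_const_left _ _
      ((tendsto_atTop_add_const_right _ (-pmu y) hlim).const_mul_atTop_of_neg hgneg)
  refine tendsto_atBot_mono' _ ?_ hbound
  filter_upwards [Ioo_mem_nhdsGT hy0] with x hx
  linarith [hle x y hx.1 hx.2 hy]
end
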